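/- arXiv:2201.03264 — 3 statements merged into one kernel-verified Lean document; each statement's English description precedes it below -/
import Mathlib

section
/- If c = 0 and a·b < 0, then the origin is a repelling equilibrium of the Kukles system (K): the origin is Lyapunov stable for the time-reversed flow, and there exists δ > 0 such that every solution γ of (K) with ‖γ(0)‖ < δ is defined for all t ≤ 0 and satisfies γ(t) → (0,0) as t → −∞. -/
/-- The Kukles vector field `(−y, x + y(x²+y²−1)(ax+by+c))`. -/
def kuklesField (a b c : ℝ) (p : ℝ × ℝ) : ℝ × ℝ :=
  (-p.2, p.1 + p.2 * (p.1 ^ 2 + p.2 ^ 2 - 1) * (a * p.1 + b * p.2 + c))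

/-- Lyapunov function: quadratic, cubic and quartic parts. -/
noncomputable def kuklesV (a b x y : ℝ) : ℝ :=
  (x ^ 2 + y ^ 2) / 2 + (a / 3 * y ^ 3 - b * x * y ^ 2 - 2 * b / 3 * x ^ 3)
    + ((a ^ 2 - 2 * b ^ 2) / 4 * y ^ 4 + a * b * (-(x ^ 3 * y) / 8 - 7 / 8 * (x * y ^ 3)))

/-- Its derivative along the flow. -/
noncomputable def kuklesVD (a b x y : ℝ) : ℝ :=
  (x + (-b * y ^ 2 - 2 * b * x ^ 2)
    + a * b * (-(3 * x ^ 2 * y) / 8 - 7 / 8 * y ^ 3)) * (-y)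
  + (y + (a * y ^ 2 - 2 * b * x * y)
    + ((a ^ 2 - 2 * b ^ 2) * y ^ 3 + a * b * (-(x ^ 3) / 8 - 21 / 8 * (x * y ^ 2))))
    * (x + y * (x ^ 2 + y ^ 2 - 1) * (a * x + b * y))

theorem kukles_bdd (Q : ℝ × ℝ × ℝ → ℝ) (hQ : Continuous Q) :
    ∃ C > (0:ℝ), ∀ r u v : ℝ, |r| ≤ 1 → |u| ≤ 1 → |v| ≤ 1 → |Q (r, u, v)| ≤ C := by
  obtain ⟨C, hC⟩ := (isCompact_closedBall (0 : ℝ × ℝ × ℝ) 1).exists_bound_of_continuousOn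
    hQ.continuousOn
  refine ⟨max C 1, by positivity, fun r u v hr hu hv => ?_⟩
  refine le_trans (hC (r, u, v) ?_) (le_max_left _ _)
  simp [Prod.norm_def, hr, hu, hv]

theorem kukles_polar (x y r : ℝ) (hr : 0 ≤ r) (h : r ^ 2 = x ^ 2 + y ^ 2) :
    ∃ u v : ℝ, u ^ 2 + v ^ 2 = 1 ∧ x = r * u ∧ y = r * v := by
  rcases hr.eq_or_lt with h0 | h0
  · subst h0
    refine ⟨1, 0, by norm_num, ?_, ?_⟩ <;> nlinarith [sq_nonneg x, sq_nonneg y]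
  · refine ⟨x / r, y / r, ?_, ?_, ?_⟩ <;> field_simp
    linarith

theorem kukles_est (a b : ℝ) (hab : a * b < 0) :
    ∃ ρ > (0:ℝ), ∀ x y : ℝ, x ^ 2 + y ^ 2 ≤ ρ ^ 2 →
      (x ^ 2 + y ^ 2) / 4 ≤ kuklesV a b x y ∧ kuklesV a b x y ≤ x ^ 2 + y ^ 2 ∧
      (-(a * b) / 16) * (x ^ 2 + y ^ 2) ^ 2 ≤ kuklesVD a b x y := by
  obtain ⟨C, hC, hC'⟩ := kukles_bdd (fun p =>
    (a / 3 * p.2.2 ^ 3 - b * p.2.1 * p.2.2 ^ 2 - 2 * b / 3 * p.2.1 ^ 3)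
    + p.1 * ((a ^ 2 - 2 * b ^ 2) / 4 * p.2.2 ^ 4
      + a * b * (-(p.2.1 ^ 3 * p.2.2) / 8 - 7 / 8 * (p.2.1 * p.2.2 ^ 3)))) (by fun_prop)
  obtain ⟨D, hD, hD'⟩ := kukles_bdd (fun p =>
    p.2.2 ^ 2 * (a * p.2.1 + b * p.2.2)
    + p.1 * (a * p.2.2 ^ 2 - 2 * b * p.2.1 * p.2.2) * p.2.2 * (a * p.2.1 + b * p.2.2)
    + ((a ^ 2 - 2 * b ^ 2) * p.2.2 ^ 3
        + a * b * (-(p.2.1 ^ 3) / 8 - 21 / 8 * (p.2.1 * p.2.2 ^ 2)))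
      * p.2.2 * (p.1 ^ 2 - 1) * (a * p.2.1 + b * p.2.2)) (by fun_prop)
  have hK : 0 < -(a * b) := by linarith
  refine ⟨min 1 (min (1 / (4 * C)) (-(a * b) / (16 * D))), by positivity, fun x y hxy => ?_⟩
  obtain ⟨r, hr, hrq⟩ : ∃ r : ℝ, 0 ≤ r ∧ r ^ 2 = x ^ 2 + y ^ 2 :=
    ⟨√(x ^ 2 + y ^ 2), Real.sqrt_nonneg _, Real.sq_sqrt (by positivity)⟩
  obtain ⟨u, v, huv, rfl, rfl⟩ := kukles_polar x y r hr hrq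
  rw [← hrq] at hxy ⊢
  have hrr := (pow_le_pow_iff_left₀ hr (by positivity) two_ne_zero).1 hxy
  have h1 : r ≤ 1 := hrr.trans (min_le_left _ _)
  have h2 : r ≤ 1 / (4 * C) := hrr.trans ((min_le_right _ _).trans (min_le_left _ _))
  have h3 : r ≤ -(a * b) / (16 * D) := hrr.trans ((min_le_right _ _).trans (min_le_right _ _))
  rw [le_div_iff₀ (by positivity)] at h2 h3
  have hra : |r| ≤ 1 := by rwa [abs_of_nonneg hr]
  have hu : |u| ≤ 1 := abs_le_one_iff_mul_self_le_one.2 (by nlinarith [sq_nonneg v])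
  have hv : |v| ≤ 1 := abs_le_one_iff_mul_self_le_one.2 (by nlinarith [sq_nonneg u])
  have e1 := abs_le.1 (hC' r u v hra hu hv)
  have e2 := abs_le.1 (hD' r u v hra hu hv)
  simp only at e1 e2
  have hV : ∀ Q : ℝ, Q = (a / 3 * v ^ 3 - b * u * v ^ 2 - 2 * b / 3 * u ^ 3)
    + r * ((a ^ 2 - 2 * b ^ 2) / 4 * v ^ 4
      + a * b * (-(u ^ 3 * v) / 8 - 7 / 8 * (u * v ^ 3))) →
      kuklesV a b (r * u) (r * v) = r ^ 2 * (1 / 2 + r * Q) := by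
    rintro Q rfl
    unfold kuklesV
    linear_combination (r ^ 2 / 2) * huv
  have hVD : ∀ Q : ℝ, Q = v ^ 2 * (a * u + b * v)
    + r * (a * v ^ 2 - 2 * b * u * v) * v * (a * u + b * v)
    + ((a ^ 2 - 2 * b ^ 2) * v ^ 3
        + a * b * (-(u ^ 3) / 8 - 21 / 8 * (u * v ^ 2)))
      * v * (r ^ 2 - 1) * (a * u + b * v) →
      kuklesVD a b (r * u) (r * v) = r ^ 4 * (-(a * b) / 8 + r * Q) := by
    rintro Q rfl
    unfold kuklesVD
    have hq : (r * u) ^ 2 + (r * v) ^ 2 = r ^ 2 := hrq.symm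
    rw [hq]
    linear_combination (-(a * b) / 8 * r ^ 4 * (u ^ 2 + v ^ 2 + 1)) * huv
  generalize hQ1 : (a / 3 * v ^ 3 - b * u * v ^ 2 - 2 * b / 3 * u ^ 3)
    + r * ((a ^ 2 - 2 * b ^ 2) / 4 * v ^ 4
      + a * b * (-(u ^ 3 * v) / 8 - 7 / 8 * (u * v ^ 3))) = Q1 at e1
  generalize hQ2 : v ^ 2 * (a * u + b * v)
    + r * (a * v ^ 2 - 2 * b * u * v) * v * (a * u + b * v)
    + ((a ^ 2 - 2 * b ^ 2) * v ^ 3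
        + a * b * (-(u ^ 3) / 8 - 21 / 8 * (u * v ^ 2)))
      * v * (r ^ 2 - 1) * (a * u + b * v) = Q2 at e2
  rw [hV Q1 hQ1.symm, hVD Q2 hQ2.symm]
  clear hV hVD hQ1 hQ2 hC' hD'
  have g1 := mul_le_mul_of_nonneg_left e1.1 hr
  have g2 := mul_le_mul_of_nonneg_left e1.2 hr
  have g3 := mul_le_mul_of_nonneg_left e2.1 hr
  have f1 : -(1 / 4) ≤ r * Q1 := by linarith
  have f2 : r * Q1 ≤ 1 / 4 := by linarith
  have f3 : -(-(a * b) / 16) ≤ r * Q2 := by linarith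
  refine ⟨?_, ?_, ?_⟩
  · linarith [mul_le_mul_of_nonneg_left f1 (sq_nonneg r)]
  · linarith [mul_le_mul_of_nonneg_left f2 (sq_nonneg r), sq_nonneg r]
  · linarith [mul_le_mul_of_nonneg_left f3 (pow_nonneg hr 4)]

theorem kukles_hasDeriv (a b : ℝ) (γ : ℝ → ℝ × ℝ) (t : ℝ)
    (h : HasDerivAt γ (kuklesField a b 0 (γ t)) t) :
    HasDerivAt (fun s => kuklesV a b (γ s).1 (γ s).2) (kuklesVD a b (γ t).1 (γ t).2) t := by
  have hx : HasDerivAt (fun s => (γ s).1) (kuklesField a b 0 (γ t)).1 t :=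
    (hasFDerivAt_fst (𝕜 := ℝ) (p := γ t)).comp_hasDerivAt t h
  have hy : HasDerivAt (fun s => (γ s).2) (kuklesField a b 0 (γ t)).2 t :=
    (hasFDerivAt_snd (𝕜 := ℝ) (p := γ t)).comp_hasDerivAt t h
  have H := ((((hx.pow 2).add (hy.pow 2)).div_const 2).add
    ((((hy.pow 3).const_mul (a / 3)).sub ((hx.const_mul b).mul (hy.pow 2))).sub
      ((hx.pow 3).const_mul (2 * b / 3)))).add
    (((hy.pow 4).const_mul ((a ^ 2 - 2 * b ^ 2) / 4)).add
      (((((hx.pow 3).mul hy).neg.div_const 8).sub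
        ((hx.mul (hy.pow 3)).const_mul (7 / 8))).const_mul (a * b)))
  refine HasDerivAt.congr_deriv (f := fun s => kuklesV a b (γ s).1 (γ s).2) H ?_
  simp only [kuklesField, kuklesVD, Pi.pow_apply]
  norm_num
  ring

theorem kukles_mvt (f f' : ℝ → ℝ) (m s e : ℝ) (hse : s ≤ e)
    (hf : ∀ t, s ≤ t → t ≤ e → HasDerivAt f (f' t) t)
    (hm : ∀ t, s ≤ t → t ≤ e → m ≤ f' t) : f s + m * (e - s) ≤ f e := by
  rcases hse.eq_or_lt with h | h
  · subst h; simp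
  · obtain ⟨c, hc, hc'⟩ := exists_hasDerivAt_eq_slope f f' h
      (fun t ht => (hf t ht.1 ht.2).continuousAt.continuousWithinAt)
      (fun t ht => hf t ht.1.le ht.2.le)
    have := hm c hc.1.le hc.2.le
    rw [hc', le_div_iff₀ (by linarith)] at this
    linarith

theorem kukles_norm (p : ℝ × ℝ) (ε : ℝ) (hε : 0 < ε) (h : p.1 ^ 2 + p.2 ^ 2 < ε ^ 2) :
    ‖p‖ < ε := by
  rw [Prod.norm_def, max_lt_iff]
  exact ⟨abs_lt_of_sq_lt_sq (by nlinarith [sq_nonneg p.2]) hε.le,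
    abs_lt_of_sq_lt_sq (by nlinarith [sq_nonneg p.1]) hε.le⟩

theorem kukles_norm' (p : ℝ × ℝ) (η : ℝ) (h : ‖p‖ < η / 4) :
    p.1 ^ 2 + p.2 ^ 2 < η ^ 2 / 4 := by
  rw [Prod.norm_def, max_lt_iff] at h
  have h1 := abs_lt.1 h.1
  have h2 := abs_lt.1 h.2
  nlinarith

theorem kukles_stay (a b : ℝ) (ρ : ℝ) (hab : a * b < 0)
    (hρ : ∀ x y : ℝ, x ^ 2 + y ^ 2 ≤ ρ ^ 2 →
      (x ^ 2 + y ^ 2) / 4 ≤ kuklesV a b x y ∧ kuklesV a b x y ≤ x ^ 2 + y ^ 2 ∧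
      (-(a * b) / 16) * (x ^ 2 + y ^ 2) ^ 2 ≤ kuklesVD a b x y)
    (η : ℝ) (hη : 0 < η) (hηρ : η ≤ ρ) (γ : ℝ → ℝ × ℝ)
    (hγ : ∀ t : ℝ, t ≤ 0 → HasDerivAt γ (kuklesField a b 0 (γ t)) t)
    (h0 : ‖γ 0‖ < η / 4) (t : ℝ) (ht : t ≤ 0) : (γ t).1 ^ 2 + (γ t).2 ^ 2 < η ^ 2 := by
  by_contra! hcon
  have hη2 : η ^ 2 ≤ ρ ^ 2 := by gcongr
  have hcont : ContinuousOn (fun s => (γ s).1 ^ 2 + (γ s).2 ^ 2) (Set.Icc t 0) := by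
    have : ContinuousOn γ (Set.Icc t 0) := fun s hs => (hγ s hs.2).continuousAt.continuousWithinAt
    fun_prop
  have hcl := hcont.preimage_isClosed_of_isClosed isClosed_Icc (isClosed_Ici (a := η ^ 2))
  have hcp := isCompact_Icc.of_isClosed_subset hcl Set.inter_subset_left
  obtain ⟨t0, ⟨ht0, hq⟩, hgr⟩ := hcp.exists_isGreatest ⟨t, ⟨le_refl t, ht⟩, hcon⟩
  have hlt : ∀ s, t0 < s → s ≤ 0 → (γ s).1 ^ 2 + (γ s).2 ^ 2 < η ^ 2 := by
    intro s hs hs0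
    by_contra! hc
    exact absurd (hgr ⟨⟨ht0.1.trans hs.le, hs0⟩, hc⟩) (not_le.2 hs)
  simp only [Set.mem_preimage, Set.mem_Ici] at hq
  have hn := kukles_norm' _ _ h0
  have ht00 : t0 < 0 := by
    refine lt_of_le_of_ne ht0.2 ?_
    rintro rfl
    nlinarith
  have hle : (γ t0).1 ^ 2 + (γ t0).2 ^ 2 ≤ η ^ 2 := by
    have hct : ContinuousAt (fun s => (γ s).1 ^ 2 + (γ s).2 ^ 2) t0 := by
      have := (hγ t0 ht0.2).continuousAt
      fun_prop
    refine le_of_tendsto (hct.tendsto.mono_left (nhdsWithin_le_nhds (s := Set.Ioi t0))) ?_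
    filter_upwards [Ioo_mem_nhdsGT ht00] with s hs
    exact (hlt s hs.1 hs.2.le).le
  have hall : ∀ s, t0 ≤ s → s ≤ 0 → (γ s).1 ^ 2 + (γ s).2 ^ 2 ≤ ρ ^ 2 := by
    intro s hs hs0
    rcases hs.eq_or_lt with h | h
    · subst h; linarith
    · linarith [hlt s h hs0]
  have hm := kukles_mvt (fun s => kuklesV a b (γ s).1 (γ s).2)
    (fun s => kuklesVD a b (γ s).1 (γ s).2) 0 t0 0 ht0.2
    (fun s _ hs => kukles_hasDeriv a b γ s (hγ s hs))
    (fun s hs hs0 => le_trans (mul_nonneg (by linarith) (sq_nonneg _))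
      (hρ _ _ (hall s hs hs0)).2.2)
  have e1 := (hρ _ _ (hall t0 le_rfl ht0.2)).1
  have e2 := (hρ _ _ (hall 0 ht0.2 le_rfl)).2.1
  linarith

/-- If `c = 0` and `a·b < 0`, the origin is a repelling equilibrium of
the Kukles system: it is Lyapunov stable for the time-reversed flow, and there is
`δ > 0` such that every solution defined for all `t ≤ 0` with `‖γ(0)‖ < δ`
satisfies `γ(t) → (0,0)` as `t → −∞`. -/
theorem kukles_origin_repelling (a b c : ℝ) (hc : c = 0) (hab : a * b < 0) :
    (∀ ε > (0:ℝ), ∃ δ > (0:ℝ), ∀ γ : ℝ → ℝ × ℝ,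
        (∀ t : ℝ, t ≤ 0 → HasDerivAt γ (kuklesField a b c (γ t)) t) →
        ‖γ 0‖ < δ → ∀ t : ℝ, t ≤ 0 → ‖γ t‖ < ε) ∧
    (∃ δ > (0:ℝ), ∀ γ : ℝ → ℝ × ℝ,
        (∀ t : ℝ, t ≤ 0 → HasDerivAt γ (kuklesField a b c (γ t)) t) →
        ‖γ 0‖ < δ →
        Filter.Tendsto γ Filter.atBot (nhds ((0:ℝ), (0:ℝ)))) := by
  subst hc
  obtain ⟨ρ, hρ0, hρ⟩ := kukles_est a b hab
  constructor
  · intro ε hε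
    have hη : 0 < min ε ρ := lt_min hε hρ0
    refine ⟨min ε ρ / 4, by positivity, fun γ hγ h0 t ht => ?_⟩
    exact (kukles_norm _ _ hη
      (kukles_stay a b ρ hab hρ _ hη (min_le_right _ _) γ hγ h0 t ht)).trans_le (min_le_left _ _)
  · refine ⟨ρ / 4, by positivity, fun γ hγ h0 => ?_⟩
    have hst : ∀ t, t ≤ 0 → (γ t).1 ^ 2 + (γ t).2 ^ 2 ≤ ρ ^ 2 := fun t ht =>
      (kukles_stay a b ρ hab hρ _ hρ0 le_rfl γ hγ h0 t ht).le
    have hd : ∀ t, t ≤ 0 → HasDerivAt (fun s => kuklesV a b (γ s).1 (γ s).2)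
        (kuklesVD a b (γ t).1 (γ t).2) t := fun t ht => kukles_hasDeriv a b γ t (hγ t ht)
    rw [Metric.tendsto_nhds]
    intro ε hε
    set m := ε ^ 2 / 4 with hm
    have hm0 : 0 < m := by positivity
    set k := (-(a * b) / 16) * m ^ 2 with hk
    have hk0 : 0 < k := mul_pos (by linarith) (by positivity)
    filter_upwards [Filter.eventually_lt_atBot (-(ρ ^ 2 / k)),
      Filter.eventually_le_atBot 0] with t ht ht0
    change dist (γ t) 0 < ε
    rw [dist_zero_right]
    apply kukles_norm _ _ hε
    by_contra! hcon
    have e1 := (hρ _ _ (hst t ht0)).1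
    have hVm : ∀ s, t ≤ s → s ≤ 0 → m ≤ kuklesV a b (γ s).1 (γ s).2 := by
      intro s hs hs0
      have := kukles_mvt (fun s => kuklesV a b (γ s).1 (γ s).2)
        (fun s => kuklesVD a b (γ s).1 (γ s).2) 0 t s hs
        (fun u _ hu => hd u (hu.trans hs0))
        (fun u _ hu => le_trans (mul_nonneg (by linarith) (sq_nonneg _))
          (hρ _ _ (hst u (hu.trans hs0))).2.2)
      linarith
    have := kukles_mvt (fun s => kuklesV a b (γ s).1 (γ s).2)
        (fun s => kuklesVD a b (γ s).1 (γ s).2) k t 0 ht0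
        (fun u _ hu => hd u hu)
        (fun u hu hu0 => by
          obtain ⟨_, h2, h3⟩ := hρ _ _ (hst u hu0)
          refine le_trans ?_ h3
          have := hVm u hu hu0
          exact mul_le_mul_of_nonneg_left (by gcongr; linarith) (by linarith))
    have e2 := (hρ _ _ (hst 0 le_rfl)).2.1
    have e3 := hst 0 le_rfl
    have e4 : ρ ^ 2 / k < -t := by linarith
    rw [div_lt_iff₀ hk0] at e4
    nlinarith [hVm t le_rfl ht0]
end

section
/- For every r > 0 there exists a nonempty open set N ⊂ ℝ³ such that for every parameter vector (a,b,c) ∈ N, the Kukles system (K) has a small-amplitude limit cycle contained in the open ball of radius r centered at the origin: there is a nonconstant periodic solution whose image Γ lies in {(x,y) : x² + y² < r²}, and there is an open neighborhood U of Γ such that every nonconstant periodic solution with image contained in U has image equal to Γ. -/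
/-- `γ` is a solution of the Kukles system `ẋ = −y, ẏ = x + y(x²+y²−1)(ax+by+c)`. -/
def IsKuklesSol (a b c : ℝ) (γ : ℝ → ℝ × ℝ) : Prop :=
  ∀ t : ℝ, HasDerivAt γ
    (-(γ t).2,
      (γ t).1 + (γ t).2 * ((γ t).1 ^ 2 + (γ t).2 ^ 2 - 1) *
        (a * (γ t).1 + b * (γ t).2 + c)) t

/-- `γ` is periodic: `γ(t+T) = γ(t)` for some `T > 0`. -/
def IsPeriodicCurve (γ : ℝ → ℝ × ℝ) : Prop :=
  ∃ T > (0:ℝ), ∀ t : ℝ, γ (t + T) = γ t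

/-- `γ` is nonconstant. -/
def IsNonconstCurve (γ : ℝ → ℝ × ℝ) : Prop :=
  ∃ t s : ℝ, γ t ≠ γ s


open Set Real in
theorem kk_var_bound (F : ℝ → ℝ → ℝ) (B : ℝ) (hB : ∀ θ ρ, |F θ ρ| ≤ B) (v : ℝ → ℝ)
    (hv : ∀ θ ∈ Icc 0 (2*π), HasDerivWithinAt v (F θ (v θ)) (Icc 0 (2*π)) θ)
    (θ : ℝ) (hθ : θ ∈ Icc 0 (2*π)) : |v θ - v 0| ≤ B * (2*π) := by
  have hpi := Real.pi_pos
  have h := Convex.norm_image_sub_le_of_norm_hasDerivWithin_le (f := v) (C := B) hv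
    (fun x _ => by rw [Real.norm_eq_abs]; exact hB _ _) (convex_Icc 0 (2*π))
    (left_mem_Icc.2 (by positivity)) hθ
  simp only [Real.norm_eq_abs, sub_zero] at h
  refine h.trans ?_
  have hB0 : 0 ≤ B := (abs_nonneg _).trans (hB 0 0)
  rw [abs_of_nonneg hθ.1]
  exact mul_le_mul_of_nonneg_left hθ.2 hB0

open Set Real in
theorem kk_periodic_exists (F : ℝ → ℝ → ℝ) (K B : NNReal)
    (hF : ∀ ρ, Continuous (fun θ => F θ ρ)) (hL : ∀ θ, LipschitzWith K (F θ))
    (hB : ∀ θ ρ, |F θ ρ| ≤ B) (hper : ∀ θ ρ, F (θ + 2*π) ρ = F θ ρ)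
    (lo hi : ℝ) (hlh : lo ≤ hi)
    (hhi : ∀ v : ℝ → ℝ, v 0 = hi →
      (∀ θ ∈ Icc 0 (2*π), HasDerivWithinAt v (F θ (v θ)) (Icc 0 (2*π)) θ) → v (2*π) ≤ hi)
    (hlo : ∀ v : ℝ → ℝ, v 0 = lo →
      (∀ θ ∈ Icc 0 (2*π), HasDerivWithinAt v (F θ (v θ)) (Icc 0 (2*π)) θ) → lo ≤ v (2*π)) :
    ∃ R : ℝ → ℝ, (∀ θ, HasDerivAt R (F θ (R θ)) θ) ∧ Function.Periodic R (2*π) ∧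
      R 0 ∈ Icc lo hi ∧ ∀ θ, |R θ - R 0| ≤ B * (2*π) := by
  have hpi := Real.pi_pos
  have h2pi : 0 < 2*π := by positivity
  let r : NNReal := ⟨hi - lo, by linarith⟩
  let a : NNReal := r + B * ⟨2*π, h2pi.le⟩
  have hPL : IsPicardLindelof F (tmin := 0) (tmax := 2*π) ⟨0, left_mem_Icc.2 h2pi.le⟩ lo a r B K := by
    refine ⟨fun t _ => (hL t).lipschitzOnWith, fun x _ => (hF x).continuousOn,
      fun t _ x _ => by rw [Real.norm_eq_abs]; exact hB _ _, ?_⟩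
    simp only [sub_zero, sub_self]
    rw [max_eq_left h2pi.le]
    change (B:ℝ) * (2*π) ≤ (hi - lo + B * (2*π)) - (hi - lo)
    linarith
  obtain ⟨Φ, hΦ, hc⟩ := hPL.exists_forall_mem_closedBall_eq_hasDerivWithinAt_continuousOn
  have hball : ∀ x ∈ Icc lo hi, x ∈ Metric.closedBall lo r := by
    intro x hx
    rw [Metric.mem_closedBall, Real.dist_eq, abs_of_nonneg (by linarith [hx.1])]
    change x - lo ≤ hi - lo
    linarith [hx.2]
  have hcont : ContinuousOn (fun x => Φ (x, 2*π) - x) (Icc lo hi) := by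
    refine ContinuousOn.sub ?_ continuousOn_id
    refine hc.comp (by fun_prop) ?_
    intro x hx
    exact ⟨hball x hx, right_mem_Icc.2 h2pi.le⟩
  have hloI : lo ∈ Icc lo hi := left_mem_Icc.2 hlh
  have hhiI : hi ∈ Icc lo hi := right_mem_Icc.2 hlh
  have hz : (0:ℝ) ∈ Icc (Φ (hi, 2*π) - hi) (Φ (lo, 2*π) - lo) := by
    have h1 := hhi (fun t => Φ (hi, t)) (hΦ hi (hball _ hhiI)).1 (hΦ hi (hball _ hhiI)).2
    have h2 := hlo (fun t => Φ (lo, t)) (hΦ lo (hball _ hloI)).1 (hΦ lo (hball _ hloI)).2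
    beta_reduce at h1 h2
    constructor <;> linarith
  obtain ⟨x, hx, hx0⟩ := intermediate_value_Icc' hlh hcont hz
  simp only at hx0
  let v : ℝ → ℝ := fun t => Φ (x, t)
  have hv0 : v 0 = x := (hΦ x (hball _ hx)).1
  have hv : ∀ θ ∈ Icc 0 (2*π), HasDerivWithinAt v (F θ (v θ)) (Icc 0 (2*π)) θ :=
    (hΦ x (hball _ hx)).2
  have hv1 : v (2*π) = x := by change Φ (x, 2*π) = x; linarith
  have hvc : ContinuousOn v (Icc 0 (2*π)) := fun θ hθ => (hv θ hθ).continuousWithinAt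
  have : Fact (0 < 2*π) := ⟨h2pi⟩
  let R : ℝ → ℝ := fun t => AddCircle.liftIco (2*π) 0 v (t : AddCircle (2*π))
  have hRc : Continuous R :=
    (AddCircle.liftIco_zero_continuous (by rw [hv0, hv1]) hvc).comp (AddCircle.continuous_mk' _)
  have hRper : Function.Periodic R (2*π) := by
    intro t
    change AddCircle.liftIco (2*π) 0 v ((t + 2*π : ℝ) : AddCircle (2*π)) = _
    rw [AddCircle.coe_add_period]
  have hRv : ∀ t ∈ Icc 0 (2*π), R t = v t := by
    intro t ht
    rcases lt_or_eq_of_le ht.2 with h | h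
    · exact AddCircle.liftIco_zero_coe_apply ⟨ht.1, h⟩
    · have := hRper 0
      rw [zero_add] at this
      rw [h, this, hv1, ← hv0]
      exact AddCircle.liftIco_zero_coe_apply ⟨le_rfl, h2pi⟩
  have hFc : Continuous (Function.uncurry F) :=
    continuous_prod_of_continuous_lipschitzWith' (Function.uncurry F) K hL hF
  let g : ℝ → ℝ := fun t => F t (R t)
  have hg : Continuous g := hFc.comp (by fun_prop : Continuous fun t => (t, R t))
  have hgper : Function.Periodic g (2*π) := by
    intro t
    simp only [g, hRper t, hper]
  have hint : ∀ t ∈ Icc 0 (2*π), ∫ s in (0:ℝ)..t, g s = v t - v 0 := by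
    intro t ht
    have hsub : Icc 0 t ⊆ Icc 0 (2*π) := Icc_subset_Icc le_rfl ht.2
    refine intervalIntegral.integral_eq_sub_of_hasDeriv_right_of_le ht.1 (hvc.mono hsub) ?_
      (hg.intervalIntegrable _ _)
    intro y hy
    have hy' : y ∈ Icc 0 (2*π) := hsub ⟨hy.1.le, hy.2.le⟩
    have := (hv y hy').hasDerivAt (Icc_mem_nhds hy.1 (hy.2.trans_le ht.2))
    simp only [g, hRv y hy']
    exact this.hasDerivWithinAt
  have hall : ∀ t, R t = x + ∫ s in (0:ℝ)..t, g s := by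
    have hS : Function.Periodic (fun t => x + ∫ s in (0:ℝ)..t, g s) (2*π) := by
      intro t
      simp only
      rw [← intervalIntegral.integral_add_adjacent_intervals (hg.intervalIntegrable 0 t)
        (hg.intervalIntegrable t _), hgper.intervalIntegral_add_eq t 0, zero_add,
        hint _ (right_mem_Icc.2 h2pi.le), hv0, hv1]
      ring
    intro t
    obtain ⟨y, hy, hty⟩ := (hRper.sub hS).exists_mem_Ico₀ h2pi t
    have : R y - (x + ∫ s in (0:ℝ)..y, g s) = 0 := by
      rw [hRv y (Ico_subset_Icc_self hy), hint y (Ico_subset_Icc_self hy), hv0]; ring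
    simp only [Pi.sub_apply] at hty
    linarith
  have hR0 : R 0 = x := by rw [hRv 0 (left_mem_Icc.2 h2pi.le), hv0]
  refine ⟨R, ?_, hRper, hR0 ▸ hx, ?_⟩
  · intro θ
    have h1 := (intervalIntegral.integral_hasDerivAt_right (hg.intervalIntegrable 0 θ)
      (hg.stronglyMeasurableAtFilter _ _) hg.continuousAt).const_add x
    exact h1.congr_of_eventuallyEq (Filter.Eventually.of_forall hall)
  · intro θ
    obtain ⟨y, hy, hty⟩ := hRper.exists_mem_Ico₀ h2pi θ
    have := kk_var_bound F B hB v hv y (Ico_subset_Icc_self hy)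
    rw [hty, hR0, hRv y (Ico_subset_Icc_self hy), ← hv0]
    exact this

/-- First-order corrector. -/
noncomputable def kkG (α β c s : ℝ) : ℝ := α * s^3/3 + β * (-c + c^3/3)
/-- Angular derivative of the first-order corrector. -/
def kkdG (α β c s : ℝ) : ℝ := s^2 * (α * c + β * s)
/-- Part of the second-order corrector. -/
noncomputable def kkJ (α β c s : ℝ) : ℝ :=
  α^2 * (s^4/4 - s^6/6) + 2*α*β*(s^5*c/6 - s^3*c/24 - s*c/16) + β^2*s^6/6
/-- Angular derivative of `kkJ`. -/
noncomputable def kkdJ (α β c s : ℝ) : ℝ :=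
  α^2 * (s^3*c^3) + 2*α*β*(s^4*c^2 - 1/16) + β^2*(s^5*c)
/-- Second-order corrector. -/
noncomputable def kkH (α β c s : ℝ) : ℝ := (kkG α β c s)^2/2 + kkJ α β c s
/-- Angular derivative of the second-order corrector. -/
noncomputable def kkdH (α β c s : ℝ) : ℝ := kkG α β c s * kkdG α β c s + kkdJ α β c s
/-- The perturbation term. -/
def kkQ (δ α β γ ρ c s : ℝ) : ℝ := -s * (1 - δ^2*ρ^2) * (ρ * (α*c + β*s) + δ*γ)
/-- The angular speed. -/
def kkD (δ α β γ ρ c s : ℝ) : ℝ := 1 + δ * c * kkQ δ α β γ ρ c s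
/-- Averaged right-hand side. -/
noncomputable def kkm (α β γ ρ : ℝ) : ℝ := -γ/2 - α*β*ρ^2/8
/-- Second and higher coefficients of the perturbation. -/
def kkT (δ α β γ ρ c s : ℝ) : ℝ := -s*γ + δ * (s*ρ^2*(ρ*(α*c+β*s)+δ*γ))
/-- Numerator of the third-order remainder. -/
noncomputable def kkN (δ α β γ ρ c s : ℝ) : ℝ :=
  s * (s*ρ^2*(ρ*(α*c+β*s)+δ*γ)) + ρ * kkG α β c s * s * kkT δ α β γ ρ c s
  + 2*ρ^2*kkH α β c s * s * kkQ δ α β γ ρ c s + ρ * kkdG α β c s * c * kkT δ α β γ ρ c s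
  + (ρ^2*kkdH α β c s + γ*(s^2-1/2)) * c * kkQ δ α β γ ρ c s
  - kkm α β γ ρ * c * kkQ δ α β γ ρ c s
/-- Corrector without the logarithm. -/
noncomputable def kkp (δ α β γ ρ c s : ℝ) : ℝ :=
  ρ * kkG α β c s + δ * (ρ^2 * kkH α β c s + γ * (-s*c/2))
/-- The averaged slope. -/
noncomputable def kkM (δ α β γ ρ c s : ℝ) : ℝ :=
  kkm α β γ ρ + δ * (kkN δ α β γ ρ c s / kkD δ α β γ ρ c s)
/-- The reduced scalar field. -/
noncomputable def kkF (δ α β γ ρ c s : ℝ) : ℝ :=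
  δ * (ρ * s * kkQ δ α β γ ρ c s / kkD δ α β γ ρ c s)

theorem kk_identity (δ α β γ ρ c s : ℝ) :
    (1 + δ*ρ*kkG α β c s + 2*δ^2*ρ^2*kkH α β c s) * s * δ * kkQ δ α β γ ρ c s
    + (δ*ρ*kkdG α β c s + δ^2*(ρ^2*kkdH α β c s + γ*(s^2-1/2))) * kkD δ α β γ ρ c s
    = δ^2 * kkm α β γ ρ * kkD δ α β γ ρ c s + δ^3 * kkN δ α β γ ρ c s := by
  simp only [kkN, kkD, kkT, kkm, kkQ, kkdH, kkdG, kkdJ]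
  ring

theorem kk_D_lower (δ α β γ ρ c s : ℝ) (hδ : 0 ≤ δ) (hδ1 : δ ≤ 1/10) (hρ : 1/2 ≤ ρ) (hρ2 : ρ ≤ 2)
    (hc : |c| ≤ 1) (hs : |s| ≤ 1) (hα : |α| ≤ 11/10) (hβ : |β| ≤ 11/10) (hγ : |γ| ≤ 3/10) :
    1/2 ≤ kkD δ α β γ ρ c s := by
  have h1 : |α*c + β*s| ≤ 22/10 := by
    calc |α*c + β*s| ≤ |α| * |c| + |β| * |s| := by
          simpa only [abs_mul] using abs_add_le (α*c) (β*s)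
      _ ≤ 11/10 * 1 + 11/10*1 := by gcongr
      _ = 22/10 := by norm_num
  have h2 : |ρ * (α*c + β*s) + δ*γ| ≤ 45/10 := by
    calc |ρ * (α*c + β*s) + δ*γ| ≤ |ρ| * |α*c + β*s| + |δ| * |γ| := by
          simpa only [abs_mul] using abs_add_le (ρ * (α*c + β*s)) (δ*γ)
      _ ≤ 2 * (22/10) + 1/10 * (3/10) := by
          rw [abs_of_nonneg hδ, abs_of_nonneg (by linarith : (0:ℝ) ≤ ρ)]; gcongr
      _ ≤ 45/10 := by norm_num
  have h3 : |1 - δ^2*ρ^2| ≤ 1 := by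
    have : δ^2*ρ^2 ≤ (1/10)^2 * 2^2 := by gcongr
    have h0 : 0 ≤ δ^2*ρ^2 := by positivity
    rw [abs_le]; constructor <;> linarith
  have h4 : |δ * c * kkQ δ α β γ ρ c s| ≤ 1/2 := by
    unfold kkQ
    simp only [abs_mul, abs_neg]
    calc |δ| * |c| * (|s| * |1 - δ^2*ρ^2| * |ρ * (α*c + β*s) + δ*γ|)
        ≤ 1/10 * 1 * (1 * 1 * (45/10)) := by rw [abs_of_nonneg hδ]; gcongr
      _ ≤ 1/2 := by norm_num
  unfold kkD
  linarith [(abs_le.1 h4).1]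

/-- Seven real coordinates. -/
abbrev KE := ℝ × ℝ × ℝ × ℝ × ℝ × ℝ × ℝ
/-- The compact box `(δ, α, β, γ, ρ, c, s)`. -/
noncomputable def kkBox : Set KE :=
  Set.Icc ((0, -11/10, -11/10, -3/10, 1/2, -1, -1) : KE) (1/10, 11/10, 11/10, 3/10, 2, 1, 1)

theorem kk_mem_box (δ α β γ ρ c s : ℝ) (hδ : 0 ≤ δ) (hδ1 : δ ≤ 1/10) (hρ : 1/2 ≤ ρ) (hρ2 : ρ ≤ 2)
    (hc : |c| ≤ 1) (hs : |s| ≤ 1) (hα : |α| ≤ 11/10) (hβ : |β| ≤ 11/10) (hγ : |γ| ≤ 3/10) :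
    ((δ, α, β, γ, ρ, c, s) : KE) ∈ kkBox := by
  rw [abs_le] at *
  simp only [kkBox, Set.mem_Icc, Prod.mk_le_mk]
  refine ⟨⟨?_, ?_, ?_, ?_, ?_, ?_, ?_⟩, ⟨?_, ?_, ?_, ?_, ?_, ?_, ?_⟩⟩ <;> linarith

theorem kk_box_D (z : KE) (hz : z ∈ kkBox) :
    1/2 ≤ kkD z.1 z.2.1 z.2.2.1 z.2.2.2.1 z.2.2.2.2.1 z.2.2.2.2.2.1 z.2.2.2.2.2.2 := by
  obtain ⟨δ, α, β, γ, ρ, c, s⟩ := z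
  simp only [kkBox, Set.mem_Icc, Prod.mk_le_mk] at hz
  obtain ⟨⟨_, _, _, _, _, _, _⟩, ⟨_, _, _, _, _, _, _⟩⟩ := hz
  apply kk_D_lower <;> first | assumption | (rw [abs_le]; constructor <;> linarith)

/-- Uniform bounds and Lipschitz constants for a `C¹` function on the box. -/
theorem kk_box_bounds (f : KE → ℝ) (hf : ContDiffOn ℝ 1 f kkBox) :
    ∃ L : ℝ, 0 < L ∧ (∀ z ∈ kkBox, |f z| ≤ L) ∧
      ∀ δ α β γ c s ρ ρ' : ℝ, ((δ, α, β, γ, ρ, c, s) : KE) ∈ kkBox →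
        ((δ, α, β, γ, ρ', c, s) : KE) ∈ kkBox →
        |f (δ, α, β, γ, ρ, c, s) - f (δ, α, β, γ, ρ', c, s)| ≤ L * |ρ - ρ'| := by
  have hcomp : IsCompact kkBox := isCompact_Icc
  obtain ⟨K, hK⟩ := hf.exists_lipschitzOnWith one_ne_zero (convex_Icc _ _) hcomp
  obtain ⟨C, hC⟩ := hcomp.exists_bound_of_continuousOn hf.continuousOn
  refine ⟨max C K + 1, ?_, ?_, ?_⟩
  · have : (0:ℝ) ≤ K := K.2
    have := le_max_right C (K:ℝ)
    linarith
  · intro z hz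
    have := hC z hz
    rw [Real.norm_eq_abs] at this
    linarith [le_max_left C (K:ℝ)]
  · intro δ α β γ c s ρ ρ' h h'
    have := hK.dist_le_mul _ h _ h'
    rw [Real.dist_eq] at this
    have hd : dist ((δ, α, β, γ, ρ, c, s) : KE) (δ, α, β, γ, ρ', c, s) = |ρ - ρ'| := by
      simp [Prod.dist_eq, Real.dist_eq]
    rw [hd] at this
    refine this.trans (mul_le_mul_of_nonneg_right ?_ (abs_nonneg _))
    linarith [le_max_right C (K:ℝ)]

theorem kk_contDiff_D : ContDiff ℝ 1 (fun z : KE =>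
    kkD z.1 z.2.1 z.2.2.1 z.2.2.2.1 z.2.2.2.2.1 z.2.2.2.2.2.1 z.2.2.2.2.2.2) := by
  unfold kkD kkQ
  fun_prop

theorem kk_contDiff_N : ContDiff ℝ 1 (fun z : KE =>
    kkN z.1 z.2.1 z.2.2.1 z.2.2.2.1 z.2.2.2.2.1 z.2.2.2.2.2.1 z.2.2.2.2.2.2) := by
  unfold kkN kkT kkm kkdH kkH kkdJ kkJ kkdG kkG kkQ
  fun_prop

theorem kk_contDiff_p : ContDiff ℝ 1 (fun z : KE =>
    kkp z.1 z.2.1 z.2.2.1 z.2.2.2.1 z.2.2.2.2.1 z.2.2.2.2.2.1 z.2.2.2.2.2.2) := by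
  unfold kkp kkH kkJ kkG
  fun_prop

theorem kk_contDiff_Q : ContDiff ℝ 1 (fun z : KE => z.2.2.2.2.1 * z.2.2.2.2.2.2 *
    kkQ z.1 z.2.1 z.2.2.1 z.2.2.2.1 z.2.2.2.2.1 z.2.2.2.2.2.1 z.2.2.2.2.2.2) := by
  unfold kkQ
  fun_prop

theorem kk_bounds : ∃ δ₀ : ℝ, 0 < δ₀ ∧ δ₀ ≤ 1/10 ∧ ∃ L : ℝ, 0 ≤ L ∧
    ∀ δ α β γ : ℝ, 0 < δ → δ < δ₀ → 9/10 < α → α < 11/10 → 9/10 < β → β < 11/10 →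
      -3/10 < γ → γ < -2/10 → ∀ c s : ℝ, |c| ≤ 1 → |s| ≤ 1 →
      ∀ ρ ∈ Set.Icc (1/2:ℝ) 2, 1/2 ≤ kkD δ α β γ ρ c s ∧ |kkF δ α β γ ρ c s| ≤ 1/100 ∧
        (5/4 ≤ ρ → kkM δ α β γ ρ c s < 0) ∧ (ρ ≤ 3/4 → 0 < kkM δ α β γ ρ c s) ∧
        ∀ ρ' ∈ Set.Icc (1/2:ℝ) 2,
          |kkF δ α β γ ρ c s - kkF δ α β γ ρ' c s| ≤ L * |ρ - ρ'| ∧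
          (ρ < ρ' → kkM δ α β γ ρ' c s < kkM δ α β γ ρ c s ∧
            Real.log ρ + δ * kkp δ α β γ ρ c s < Real.log ρ' + δ * kkp δ α β γ ρ' c s) := by
  obtain ⟨L1, hL1, hb1, hl1⟩ := kk_box_bounds _ ((kk_contDiff_N.contDiffOn (s := kkBox)).div
    kk_contDiff_D.contDiffOn (fun z hz => by linarith [kk_box_D z hz]))
  obtain ⟨L2, hL2, hb2, hl2⟩ := kk_box_bounds _ (kk_contDiff_p.contDiffOn (s := kkBox))
  obtain ⟨L3, hL3, hb3, hl3⟩ := kk_box_bounds _ ((kk_contDiff_Q.contDiffOn (s := kkBox)).div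
    kk_contDiff_D.contDiffOn (fun z hz => by linarith [kk_box_D z hz]))
  simp only [Pi.div_apply] at hb1 hl1 hb3 hl3
  have hS : 0 < 1 + L1 + L2 + L3 := by positivity
  refine ⟨1 / (200 * (1 + L1 + L2 + L3)), by positivity, ?_, L3, hL3.le, ?_⟩
  · rw [div_le_div_iff₀ (by positivity) (by norm_num)]; linarith
  intro δ α β γ hδ hδ0 hα hα' hβ hβ' hγ hγ' c s hc hs ρ hρ
  rw [lt_div_iff₀ (by positivity)] at hδ0
  have e1 : 0 < δ * L1 := by positivity
  have e2 : 0 < δ * L2 := by positivity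
  have e3 : 0 < δ * L3 := by positivity
  have hδ1 : δ ≤ 1/10 := by linarith
  have d1 : δ * L1 < 1/200 := by linarith
  have d2 : δ * L2 < 1/200 := by linarith
  have d3 : δ * L3 < 1/200 := by linarith
  have hαβ : (81/100:ℝ) < α*β := by nlinarith
  have hαβ' : α*β < 121/100 := by nlinarith
  have hbox : ∀ r ∈ Set.Icc (1/2:ℝ) 2, ((δ, α, β, γ, r, c, s) : KE) ∈ kkBox := fun r hr =>
    kk_mem_box _ _ _ _ _ _ _ hδ.le hδ1 hr.1 hr.2 hc hs
      (abs_le.2 ⟨by linarith, by linarith⟩) (abs_le.2 ⟨by linarith, by linarith⟩)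
      (abs_le.2 ⟨by linarith, by linarith⟩)
  have hz := hbox ρ hρ
  have b1 := hb1 _ hz
  have b3 := hb3 _ hz
  have hM : |δ * (kkN δ α β γ ρ c s / kkD δ α β γ ρ c s)| < 1/200 := by
    rw [abs_mul, abs_of_pos hδ]
    exact (mul_le_mul_of_nonneg_left b1 hδ.le).trans_lt d1
  have hM' := abs_lt.1 hM
  refine ⟨kk_box_D _ hz, ?_, ?_, ?_, ?_⟩
  · unfold kkF
    rw [abs_mul, abs_of_pos hδ]
    exact (mul_le_mul_of_nonneg_left b3 hδ.le).trans (by linarith)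
  · intro h
    unfold kkM kkm
    have : (25/16:ℝ) ≤ ρ^2 := by nlinarith
    have : (81/100:ℝ) * (25/16) ≤ α*β*ρ^2 := by gcongr
    linarith [hM'.2]
  · intro h
    unfold kkM kkm
    have h0 := hρ.1
    have : ρ^2 ≤ (9/16:ℝ) := by nlinarith
    have : α*β*ρ^2 ≤ (121/100:ℝ) * (9/16) := by gcongr
    linarith [hM'.1]
  intro ρ' hρ'
  have hz' := hbox ρ' hρ'
  refine ⟨?_, fun hlt => ⟨?_, ?_⟩⟩
  · unfold kkF
    rw [← mul_sub, abs_mul, abs_of_pos hδ]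
    have := hl3 _ _ _ _ _ _ _ _ hz hz'
    refine (mul_le_mul_of_nonneg_left this hδ.le).trans ?_
    have : 0 ≤ L3 * |ρ - ρ'| := by positivity
    nlinarith
  · unfold kkM kkm
    have := hl1 _ _ _ _ _ _ _ _ hz' hz
    have h2 := (abs_le.1 this).2
    rw [abs_of_pos (by linarith : 0 < ρ' - ρ)] at h2
    have h3 := mul_le_mul_of_nonneg_left h2 hδ.le
    have h4 : ρ' - ρ ≤ ρ'^2 - ρ^2 := by nlinarith [hρ.1, hρ'.1]
    have h5 : 81/100 * (ρ' - ρ) ≤ α*β*(ρ'^2 - ρ^2) :=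
      mul_le_mul hαβ.le h4 (by linarith) (by linarith)
    have h6 : δ * (L1 * (ρ' - ρ)) ≤ 1/200 * (ρ' - ρ) := by
      rw [← mul_assoc]; exact mul_le_mul_of_nonneg_right d1.le (by linarith)
    nlinarith
  · have := hl2 _ _ _ _ _ _ _ _ hz' hz
    have h2 := (abs_le.1 this).1
    rw [abs_of_pos (by linarith : 0 < ρ' - ρ)] at h2
    have h3 := mul_le_mul_of_nonneg_left h2 hδ.le
    have hp : 0 < ρ := by linarith [hρ.1]
    have hp' : 0 < ρ' := by linarith [hρ'.1]
    have h4 : (ρ' - ρ)/2 ≤ Real.log ρ' - Real.log ρ := by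
      have := Real.log_le_sub_one_of_pos (div_pos hp hp')
      rw [Real.log_div hp.ne' hp'.ne'] at this
      have h7 : (ρ' - ρ)/2 ≤ 1 - ρ/ρ' := by
        rw [one_sub_div hp'.ne']
        exact div_le_div_of_nonneg_left (by linarith) hp' hρ'.2
      linarith
    have h6 : δ * (L2 * (ρ' - ρ)) ≤ 1/200 * (ρ' - ρ) := by
      rw [← mul_assoc]; exact mul_le_mul_of_nonneg_right d2.le (by linarith)
    simp only at h3
    have h7 : -(δ * (L2 * (ρ' - ρ))) ≤ δ * kkp δ α β γ ρ' c s - δ * kkp δ α β γ ρ c s := by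
      rw [← mul_sub, ← mul_neg]
      exact h3
    linarith

theorem kk_surj (f f' : ℝ → ℝ) (h : ∀ t, HasDerivAt f (f' t) t) (m : ℝ) (hm : 0 < m)
    (hf : ∀ t, m ≤ f' t) : Function.Surjective f := by
  have hmono : Monotone (fun t => f t - m * t) := by
    refine monotone_of_hasDerivAt_nonneg (f' := fun t => f' t - m * 1)
      (fun t => (h t).sub ((hasDerivAt_id t).const_mul m)) ?_
    intro t
    have := hf t
    simp only [Pi.zero_apply]
    linarith
  have hc : Continuous f := continuous_iff_continuousAt.2 fun t => (h t).continuousAt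
  refine hc.surjective ?_ ?_
  · have h1 : Filter.Tendsto (fun t : ℝ => f 0 + m * t) Filter.atTop Filter.atTop :=
      Filter.tendsto_atTop_add_const_left _ _ (Filter.tendsto_id.const_mul_atTop hm)
    refine Filter.tendsto_atTop_mono' _ ?_ h1
    filter_upwards [Filter.eventually_ge_atTop 0] with t ht
    have := hmono ht
    simp only [mul_zero, sub_zero] at this
    linarith
  · have h1 : Filter.Tendsto (fun t : ℝ => f 0 + m * t) Filter.atBot Filter.atBot :=
      Filter.tendsto_atBot_add_const_left _ _ (Filter.tendsto_id.const_mul_atBot hm)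
    refine Filter.tendsto_atBot_mono' _ ?_ h1
    filter_upwards [Filter.eventually_le_atBot 0] with t ht
    have := hmono ht
    simp only [mul_zero, sub_zero] at this
    linarith

open Real in
theorem kk_time (g : ℝ → ℝ) (hg : Continuous g) (hper : Function.Periodic g (2*π))
    (hpos : ∀ θ, 1/2 ≤ g θ) :
    ∃ φ : ℝ → ℝ, (∀ t, HasDerivAt φ (g (φ t)) t) ∧ Function.Surjective φ ∧
      ∃ T > 0, ∀ t, φ (t + T) = φ t + 2*π := by
  have h2pi : 0 < 2*π := by positivity
  have hne : ∀ θ, g θ ≠ 0 := fun θ => by linarith [hpos θ]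
  have hgi : Continuous (fun θ => (g θ)⁻¹) := hg.inv₀ hne
  let τ : ℝ → ℝ := fun θ => ∫ s in (0:ℝ)..θ, (g s)⁻¹
  have hτ : ∀ θ, HasDerivAt τ ((g θ)⁻¹) θ := fun θ =>
    intervalIntegral.integral_hasDerivAt_right (hgi.intervalIntegrable 0 θ)
      (hgi.stronglyMeasurableAtFilter _ _) hgi.continuousAt
  obtain ⟨C, hC⟩ := (isCompact_Icc (a := (0:ℝ)) (b := 2*π)).exists_bound_of_continuousOn
    hg.continuousOn
  have hC' : ∀ θ, g θ ≤ C := by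
    intro θ
    obtain ⟨y, hy, hty⟩ := hper.exists_mem_Ico₀ h2pi θ
    rw [hty]
    exact (le_abs_self _).trans (hC y (Set.Ico_subset_Icc_self hy))
  have hC0 : 0 < C := by linarith [hpos 0, hC' 0]
  have hsurj : Function.Surjective τ := kk_surj τ _ hτ C⁻¹ (by positivity) (fun θ =>
    inv_anti₀ (by linarith [hpos θ]) (hC' θ))
  have hmono : StrictMono τ := strictMono_of_hasDerivAt_pos hτ (fun θ => by
    have := hpos θ
    have : 0 < g θ := by linarith
    positivity)
  let e := hmono.orderIsoOfSurjective τ hsurj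
  have he : ∀ θ, e θ = τ θ := fun θ => rfl
  have hτper : ∀ θ, τ (θ + 2*π) = τ θ + τ (2*π) := by
    intro θ
    have hp : Function.Periodic (fun θ => (g θ)⁻¹) (2*π) := fun x => by simp only [hper x]
    simp only [τ]
    rw [← intervalIntegral.integral_add_adjacent_intervals (hgi.intervalIntegrable 0 θ)
        (hgi.intervalIntegrable θ _), hp.intervalIntegral_add_eq θ 0, zero_add]
  refine ⟨e.symm, ?_, e.symm.surjective, τ (2*π), ?_, ?_⟩
  · intro t
    have h1 := HasDerivAt.of_local_left_inverse (f := τ) (g := e.symm) (a := t)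
      e.symm.continuous.continuousAt (hτ _) (inv_ne_zero (hne _))
      (Filter.Eventually.of_forall fun y => e.apply_symm_apply y)
    rwa [inv_inv] at h1
  · have := hmono h2pi
    have h0 : τ 0 = 0 := by simp [τ]
    linarith
  · intro t
    apply e.injective
    rw [e.apply_symm_apply, he, hτper, ← he (e.symm t), e.apply_symm_apply]

open Real in
theorem kk_lift (x y x' y' : ℝ → ℝ) (hx : ∀ t, HasDerivAt x (x' t) t)
    (hy : ∀ t, HasDerivAt y (y' t) t) (hx' : Continuous x') (hy' : Continuous y')
    (hpos : ∀ t, 0 < x t ^2 + y t ^2) :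
    ∃ θ : ℝ → ℝ, (∀ t, HasDerivAt θ ((x t * y' t - y t * x' t)/(x t^2 + y t^2)) t) ∧
      (∀ t, x t = √(x t^2 + y t^2) * cos (θ t)) ∧ (∀ t, y t = √(x t^2 + y t^2) * sin (θ t)) := by
  have hxc : Continuous x := continuous_iff_continuousAt.2 fun t => (hx t).continuousAt
  have hyc : Continuous y := continuous_iff_continuousAt.2 fun t => (hy t).continuousAt
  have hgc : Continuous (fun t => (x t * y' t - y t * x' t)/(x t^2 + y t^2)) :=
    Continuous.div (by fun_prop) (by fun_prop) (fun t => (hpos t).ne')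
  let ω := fun t => (x t * y' t - y t * x' t)/(x t^2 + y t^2)
  obtain ⟨θ₀, h01, h02⟩ : ∃ θ₀ : ℝ, x 0 = √(x 0^2 + y 0^2) * cos θ₀ ∧
      y 0 = √(x 0^2 + y 0^2) * sin θ₀ := by
    refine ⟨Complex.arg ⟨x 0, y 0⟩, ?_, ?_⟩
    · have := Complex.norm_mul_cos_arg ⟨x 0, y 0⟩
      rw [Complex.norm_def, Complex.normSq_apply] at this
      simp only [← pow_two] at this
      exact this.symm
    · have := Complex.norm_mul_sin_arg ⟨x 0, y 0⟩
      rw [Complex.norm_def, Complex.normSq_apply] at this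
      simp only [← pow_two] at this
      exact this.symm
  let θ : ℝ → ℝ := fun t => θ₀ + ∫ s in (0:ℝ)..t, ω s
  have hθ : ∀ t, HasDerivAt θ (ω t) t := fun t =>
    (intervalIntegral.integral_hasDerivAt_right (hgc.intervalIntegrable 0 t)
      (hgc.stronglyMeasurableAtFilter _ _) hgc.continuousAt).const_add θ₀
  have hθ0 : θ 0 = θ₀ := by simp [θ]
  let r : ℝ → ℝ := fun t => √(x t^2 + y t^2)
  have hrpos : ∀ t, 0 < r t := fun t => Real.sqrt_pos.2 (hpos t)
  have hr2 : ∀ t, r t ^ 2 = x t^2 + y t^2 := fun t => Real.sq_sqrt (hpos t).le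
  have hr : ∀ t, HasDerivAt r ((x t * x' t + y t * y' t)/r t) t := by
    intro t
    have := (((hx t).pow 2).add ((hy t).pow 2)).sqrt (hpos t).ne'
    refine this.congr_deriv ?_
    have := (hrpos t).ne'
    change _ / (2 * r t) = _
    field_simp
    push_cast
    ring
  -- the rotated normalized vector is constant
  have hA : ∀ t, HasDerivAt (fun t => (x t * cos (θ t) + y t * sin (θ t)) / r t) 0 t := by
    intro t
    have h1 := (((hx t).mul (hθ t).cos).add ((hy t).mul (hθ t).sin)).div (hr t) (hrpos t).ne'
    refine h1.congr_deriv ?_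
    have h3 := (hrpos t).ne'
    have h4 : ω t = (x t * y' t - y t * x' t)/ (r t)^2 := by rw [hr2]
    rw [h4]
    have h5 := hr2 t
    simp only [Pi.add_apply, Pi.mul_apply]
    rw [div_eq_zero_iff]
    left
    field_simp
    rw [h5]
    ring
  have hB : ∀ t, HasDerivAt (fun t => (y t * cos (θ t) - x t * sin (θ t)) / r t) 0 t := by
    intro t
    have h1 := (((hy t).mul (hθ t).cos).sub ((hx t).mul (hθ t).sin)).div (hr t) (hrpos t).ne'
    refine h1.congr_deriv ?_
    have h3 := (hrpos t).ne'
    have h4 : ω t = (x t * y' t - y t * x' t)/ (r t)^2 := by rw [hr2]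
    rw [h4]
    have h5 := hr2 t
    simp only [Pi.sub_apply, Pi.mul_apply]
    rw [div_eq_zero_iff]
    left
    field_simp
    rw [h5]
    ring
  have hA1 : ∀ t, x t * cos (θ t) + y t * sin (θ t) = r t := by
    intro t
    have := is_const_of_deriv_eq_zero (fun t => (hA t).differentiableAt) (fun t => (hA t).deriv) t 0
    rw [hθ0, div_eq_iff (hrpos t).ne'] at this
    rw [this]
    have : x 0 * cos θ₀ + y 0 * sin θ₀ = r 0 := by
      change _ = √(x 0^2 + y 0^2)
      linear_combination cos θ₀ * h01 + sin θ₀ * h02 + √(x 0^2 + y 0^2) * sin_sq_add_cos_sq θ₀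
    rw [this, div_self (hrpos 0).ne', one_mul]
  have hB1 : ∀ t, y t * cos (θ t) - x t * sin (θ t) = 0 := by
    intro t
    have := is_const_of_deriv_eq_zero (fun t => (hB t).differentiableAt) (fun t => (hB t).deriv) t 0
    rw [hθ0, div_eq_iff (hrpos t).ne'] at this
    rw [this]
    have : y 0 * cos θ₀ - x 0 * sin θ₀ = 0 := by
      linear_combination cos θ₀ * h02 - sin θ₀ * h01
    rw [this, zero_div, zero_mul]
  refine ⟨θ, hθ, fun t => ?_, fun t => ?_⟩
  · change x t = r t * cos (θ t)
    linear_combination (- x t) * sin_sq_add_cos_sq (θ t) + cos (θ t) * hA1 t - sin (θ t) * hB1 t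
  · change y t = r t * sin (θ t)
    linear_combination (- y t) * sin_sq_add_cos_sq (θ t) + sin (θ t) * hA1 t + cos (θ t) * hB1 t


open Real in
theorem kk_deriv_G (α β : ℝ) (θ : ℝ → ℝ) (θ' t : ℝ) (h : HasDerivAt θ θ' t) :
    HasDerivAt (fun t => kkG α β (cos (θ t)) (sin (θ t)))
      (kkdG α β (cos (θ t)) (sin (θ t)) * θ') t := by
  unfold kkG kkdG
  have := (((h.sin.pow 3).const_mul α).div_const 3).add
    ((h.cos.neg.add ((h.cos.pow 3).div_const 3)).const_mul β)
  refine this.congr_deriv ?_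
  push_cast
  linear_combination (-β * sin (θ t) * θ') * sin_sq_add_cos_sq (θ t)

open Real in
theorem kk_deriv_J (α β : ℝ) (θ : ℝ → ℝ) (θ' t : ℝ) (h : HasDerivAt θ θ' t) :
    HasDerivAt (fun t => kkJ α β (cos (θ t)) (sin (θ t)))
      (kkdJ α β (cos (θ t)) (sin (θ t)) * θ') t := by
  unfold kkJ kkdJ
  have := (((((h.sin.pow 4).div_const 4).sub ((h.sin.pow 6).div_const 6)).const_mul (α^2)).add
    ((((((h.sin.pow 5).mul h.cos).div_const 6).sub (((h.sin.pow 3).mul h.cos).div_const 24)).sub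
      ((h.sin.mul h.cos).div_const 16)).const_mul (2*α*β))).add
    (((h.sin.pow 6).const_mul (β^2)).div_const 6)
  refine this.congr_deriv ?_
  have hc : cos (θ t) ^ 2 = 1 - sin (θ t)^2 := by linarith [sin_sq_add_cos_sq (θ t)]
  have hc3 : cos (θ t) ^ 3 = cos (θ t) * (1 - sin (θ t)^2) := by rw [← hc]; ring
  push_cast
  simp only [Pi.pow_apply]
  ring_nf
  simp only [hc, hc3]
  ring

open Real in
theorem kk_deriv_W (δ α β γ : ℝ) (ρ θ : ℝ → ℝ) (θ' t : ℝ) (hθ : HasDerivAt θ θ' t)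
    (hρ : HasDerivAt ρ (kkF δ α β γ (ρ t) (cos (θ t)) (sin (θ t)) * θ') t) (hpos : 0 < ρ t)
    (hD : 0 < kkD δ α β γ (ρ t) (cos (θ t)) (sin (θ t))) :
    HasDerivAt (fun t => Real.log (ρ t) + δ * kkp δ α β γ (ρ t) (cos (θ t)) (sin (θ t)))
      (δ^2 * kkM δ α β γ (ρ t) (cos (θ t)) (sin (θ t)) * θ') t := by
  unfold kkp kkH
  have hG := kk_deriv_G α β θ θ' t hθ
  have hJ := kk_deriv_J α β θ θ' t hθ
  have := (hρ.log hpos.ne').add (((hρ.mul hG).add ((((hρ.pow 2).mul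
    (((hG.pow 2).div_const 2).add hJ)).add
    (((hθ.sin.neg.mul hθ.cos).div_const 2).const_mul γ)).const_mul δ)).const_mul δ)
  refine this.congr_deriv ?_
  have key := kk_identity δ α β γ (ρ t) (cos (θ t)) (sin (θ t))
  have hc : cos (θ t) ^ 2 = 1 - sin (θ t)^2 := by linarith [sin_sq_add_cos_sq (θ t)]
  unfold kkM kkF
  unfold kkH kkdH at key
  simp only [Pi.pow_apply, Pi.add_apply, Pi.neg_apply]
  generalize kkD δ α β γ (ρ t) (cos (θ t)) (sin (θ t)) = D at *
  generalize kkQ δ α β γ (ρ t) (cos (θ t)) (sin (θ t)) = Q at *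
  generalize kkN δ α β γ (ρ t) (cos (θ t)) (sin (θ t)) = N at *
  generalize kkG α β (cos (θ t)) (sin (θ t)) = G at *
  generalize kkdG α β (cos (θ t)) (sin (θ t)) = dG at *
  generalize kkJ α β (cos (θ t)) (sin (θ t)) = J at *
  generalize kkdJ α β (cos (θ t)) (sin (θ t)) = dJ at *
  generalize kkm α β γ (ρ t) = m at *
  field_simp
  push_cast
  linear_combination (2 * θ') * key - (δ^2 * γ * D * θ') * hc

/-- The estimates used for fixed parameters. -/
def KKGood (δ α β γ L : ℝ) : Prop :=
  ∀ c s : ℝ, |c| ≤ 1 → |s| ≤ 1 →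
      ∀ ρ ∈ Set.Icc (1/2:ℝ) 2, 1/2 ≤ kkD δ α β γ ρ c s ∧ |kkF δ α β γ ρ c s| ≤ 1/100 ∧
        (5/4 ≤ ρ → kkM δ α β γ ρ c s < 0) ∧ (ρ ≤ 3/4 → 0 < kkM δ α β γ ρ c s) ∧
        ∀ ρ' ∈ Set.Icc (1/2:ℝ) 2,
          |kkF δ α β γ ρ c s - kkF δ α β γ ρ' c s| ≤ L * |ρ - ρ'| ∧
          (ρ < ρ' → kkM δ α β γ ρ' c s < kkM δ α β γ ρ c s ∧
            Real.log ρ + δ * kkp δ α β γ ρ c s < Real.log ρ' + δ * kkp δ α β γ ρ' c s)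

open Real Set in
theorem kk_exists_R (δ α β γ L : ℝ) (hδ : 0 < δ) (hL : 0 ≤ L) (H : KKGood δ α β γ L) :
    ∃ R : ℝ → ℝ, (∀ θ, R θ ∈ Ioo (1/2:ℝ) 2) ∧ Function.Periodic R (2*π) ∧
      ∀ θ, HasDerivAt R (kkF δ α β γ (R θ) (cos θ) (sin θ)) θ := by
  have hpi := Real.pi_pos
  have hpi4 := Real.pi_lt_d2
  have h2pi : 0 < 2*π := by positivity
  have hle : (1/2:ℝ) ≤ 2 := by norm_num
  have hcs : ∀ θ, |cos θ| ≤ 1 := abs_cos_le_one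
  have hsn : ∀ θ, |sin θ| ≤ 1 := abs_sin_le_one
  let F : ℝ → ℝ → ℝ := fun θ ρ => kkF δ α β γ (projIcc (1/2:ℝ) 2 hle ρ) (cos θ) (sin θ)
  have hFeq : ∀ θ ρ, ρ ∈ Icc (1/2:ℝ) 2 → F θ ρ = kkF δ α β γ ρ (cos θ) (sin θ) := by
    intro θ ρ hρ
    simp only [F, projIcc_of_mem hle hρ]
  have hFB : ∀ θ ρ, |F θ ρ| ≤ ((1/100 : NNReal) : ℝ) := by
    intro θ ρ
    have := (H _ _ (hcs θ) (hsn θ) _ (projIcc (1/2:ℝ) 2 hle ρ).2).2.1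
    simpa using this
  have hdrift : ∀ v : ℝ → ℝ,
      (∀ θ ∈ Icc 0 (2*π), HasDerivWithinAt v (F θ (v θ)) (Icc 0 (2*π)) θ) →
      ∀ θ ∈ Icc 0 (2*π), |v θ - v 0| ≤ 7/100 := by
    intro v hv θ hθ
    have := kk_var_bound F _ hFB v hv θ hθ
    refine this.trans ?_
    push_cast
    linarith
  have hWd : ∀ v : ℝ → ℝ,
      (∀ θ ∈ Icc 0 (2*π), HasDerivWithinAt v (F θ (v θ)) (Icc 0 (2*π)) θ) →
      (∀ θ ∈ Icc 0 (2*π), v θ ∈ Icc (1/2:ℝ) 2) →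
      ContinuousOn (fun θ => Real.log (v θ) + δ * kkp δ α β γ (v θ) (cos θ) (sin θ)) (Icc 0 (2*π)) ∧
      ∀ θ ∈ Ioo 0 (2*π), HasDerivAt
        (fun θ => Real.log (v θ) + δ * kkp δ α β γ (v θ) (cos θ) (sin θ))
        (δ^2 * kkM δ α β γ (v θ) (cos θ) (sin θ) * 1) θ := by
    intro v hv hvI
    have hvc : ContinuousOn v (Icc 0 (2*π)) := fun θ hθ => (hv θ hθ).continuousWithinAt
    refine ⟨?_, ?_⟩
    · refine ContinuousOn.add (hvc.log fun θ hθ => ?_) ?_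
      · have := (hvI θ hθ).1
        linarith
      · unfold kkp kkH kkJ kkG
        fun_prop
    · intro θ hθ
      have hθ' := Ioo_subset_Icc_self hθ
      have hvθ := hvI θ hθ'
      refine kk_deriv_W δ α β γ v id 1 θ (hasDerivAt_id θ) ?_ (by linarith [hvθ.1]) ?_
      · have := (hv θ hθ').hasDerivAt (Icc_mem_nhds hθ.1 hθ.2)
        rw [hFeq θ _ hvθ] at this
        simpa using this
      · have := (H _ _ (hcs θ) (hsn θ) _ hvθ).1
        simp only [id]
        linarith
  have hex : ∃ R : ℝ → ℝ, (∀ θ, HasDerivAt R (F θ (R θ)) θ) ∧ Function.Periodic R (2*π) ∧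
      R 0 ∈ Icc (5/8:ℝ) (3/2) ∧ ∀ θ, |R θ - R 0| ≤ ((1/100 : NNReal) : ℝ) * (2*π) := by
    refine kk_periodic_exists F L.toNNReal (1/100) ?_ ?_ hFB ?_ (5/8) (3/2) (by norm_num) ?_ ?_
    · intro ρ
      simp only [F, kkF]
      refine continuous_const.mul (Continuous.div ?_ ?_ ?_)
      · unfold kkQ; fun_prop
      · unfold kkD kkQ; fun_prop
      · intro θ
        have := (H _ _ (hcs θ) (hsn θ) _ (projIcc (1/2:ℝ) 2 hle ρ).2).1
        linarith
    · intro θ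
      refine LipschitzWith.of_dist_le_mul fun x y => ?_
      rw [Real.dist_eq, Real.coe_toNNReal _ hL]
      refine ((H _ _ (hcs θ) (hsn θ) _ (projIcc (1/2:ℝ) 2 hle x).2).2.2.2.2 _
        (projIcc (1/2:ℝ) 2 hle y).2).1.trans ?_
      refine mul_le_mul_of_nonneg_left ?_ hL
      have := (LipschitzWith.projIcc hle).dist_le_mul x y
      rw [Subtype.dist_eq, Real.dist_eq] at this
      simpa using this
    · intro θ ρ
      simp only [F, cos_add_two_pi, sin_add_two_pi]
    · intro v hv0 hv
      have hd := hdrift v hv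
      have hvI : ∀ θ ∈ Icc 0 (2*π), v θ ∈ Icc (5/4:ℝ) 2 := by
        intro θ hθ
        have := abs_le.1 (hd θ hθ)
        constructor <;> linarith [this.1, this.2]
      have hvI' : ∀ θ ∈ Icc 0 (2*π), v θ ∈ Icc (1/2:ℝ) 2 := fun θ hθ =>
        ⟨by linarith [(hvI θ hθ).1], (hvI θ hθ).2⟩
      obtain ⟨hc, hdv⟩ := hWd v hv hvI'
      have hanti := strictAntiOn_of_deriv_neg (convex_Icc 0 (2*π)) hc (by
        intro θ hθ
        rw [interior_Icc] at hθ
        rw [(hdv θ hθ).deriv]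
        have hθ' := Ioo_subset_Icc_self hθ
        have := (H _ _ (hcs θ) (hsn θ) _ (hvI' θ hθ')).2.2.1 (hvI θ hθ').1
        have h2 : 0 < δ^2 := by positivity
        nlinarith)
      have hlt := hanti (left_mem_Icc.2 h2pi.le) (right_mem_Icc.2 h2pi.le) h2pi
      by_contra hcon
      push Not at hcon
      simp only [cos_two_pi, sin_two_pi, cos_zero, sin_zero] at hlt
      have h0 := hvI' 0 (left_mem_Icc.2 h2pi.le)
      have h1 := hvI' (2*π) (right_mem_Icc.2 h2pi.le)
      have := ((H 1 0 (by simp) (by simp) _ h0).2.2.2.2 _ h1).2 (by rw [hv0]; exact hcon)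
      linarith [this.2]
    · intro v hv0 hv
      have hd := hdrift v hv
      have hvI : ∀ θ ∈ Icc 0 (2*π), v θ ∈ Icc (1/2:ℝ) (3/4) := by
        intro θ hθ
        have := abs_le.1 (hd θ hθ)
        constructor <;> linarith [this.1, this.2]
      have hvI' : ∀ θ ∈ Icc 0 (2*π), v θ ∈ Icc (1/2:ℝ) 2 := fun θ hθ =>
        ⟨(hvI θ hθ).1, by linarith [(hvI θ hθ).2]⟩
      obtain ⟨hc, hdv⟩ := hWd v hv hvI'
      have hmono := strictMonoOn_of_deriv_pos (convex_Icc 0 (2*π)) hc (by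
        intro θ hθ
        rw [interior_Icc] at hθ
        rw [(hdv θ hθ).deriv]
        have hθ' := Ioo_subset_Icc_self hθ
        have := (H _ _ (hcs θ) (hsn θ) _ (hvI' θ hθ')).2.2.2.1 (hvI θ hθ').2
        positivity)
      have hlt := hmono (left_mem_Icc.2 h2pi.le) (right_mem_Icc.2 h2pi.le) h2pi
      by_contra hcon
      push Not at hcon
      simp only [cos_two_pi, sin_two_pi, cos_zero, sin_zero] at hlt
      have h0 := hvI' 0 (left_mem_Icc.2 h2pi.le)
      have h1 := hvI' (2*π) (right_mem_Icc.2 h2pi.le)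
      have := ((H 1 0 (by simp) (by simp) _ h1).2.2.2.2 _ h0).2 (by rw [hv0]; exact hcon)
      linarith [this.2]
  obtain ⟨R, hR, hRper, hR0, hRb⟩ := hex
  have hRI : ∀ θ, R θ ∈ Ioo (1/2:ℝ) 2 := by
    intro θ
    have h1 := hRb θ
    push_cast at h1
    have h2 := abs_le.1 h1
    constructor <;> linarith [hR0.1, hR0.2, h2.1, h2.2]
  refine ⟨R, hRI, hRper, fun θ => ?_⟩
  rw [← hFeq θ _ (Ioo_subset_Icc_self (hRI θ))]
  exact hR θ

open Real Set in
theorem kk_unique (δ α β γ L : ℝ) (hδ : 0 < δ) (H : KKGood δ α β γ L)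
    (R : ℝ → ℝ) (hRI : ∀ θ, R θ ∈ Ioo (1/2:ℝ) 2) (hRper : Function.Periodic R (2*π))
    (hR : ∀ θ, HasDerivAt R (kkF δ α β γ (R θ) (cos θ) (sin θ)) θ)
    (g : ℝ → ℝ × ℝ) (hg : IsKuklesSol α β (δ^2*γ) g) (hp : IsPeriodicCurve g)
    (hU : ∀ t, δ^2/4 < (g t).1^2 + (g t).2^2 ∧ (g t).1^2 + (g t).2^2 < 4*δ^2) :
    range g = range (fun θ => (δ * R θ * cos θ, δ * R θ * sin θ)) := by
  have hcs : ∀ θ, |cos θ| ≤ 1 := abs_cos_le_one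
  have hsn : ∀ θ, |sin θ| ≤ 1 := abs_sin_le_one
  let x : ℝ → ℝ := fun t => (g t).1
  let y : ℝ → ℝ := fun t => (g t).2
  let q : ℝ → ℝ := fun t => x t + y t * (x t^2 + y t^2 - 1) * (α * x t + β * y t + δ^2*γ)
  have hx : ∀ t, HasDerivAt x (-(y t)) t := fun t => (hg t).fst
  have hy : ∀ t, HasDerivAt y (q t) t := fun t => (hg t).snd
  have hxc : Continuous x := continuous_iff_continuousAt.2 fun t => (hx t).continuousAt
  have hyc : Continuous y := continuous_iff_continuousAt.2 fun t => (hy t).continuousAt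
  have hqc : Continuous q := by fun_prop
  have hpos : ∀ t, 0 < x t^2 + y t^2 := fun t => by
    have := (hU t).1
    have h0 : 0 < δ^2/4 := by positivity
    exact h0.trans this
  obtain ⟨θ, hθ, hxθ, hyθ⟩ := kk_lift x y _ q hx hy hyc.neg hqc hpos
  let ρ : ℝ → ℝ := fun t => √(x t^2 + y t^2) / δ
  have hρr : ∀ t, √(x t^2 + y t^2) = δ * ρ t := fun t => by
    simp only [ρ]; field_simp
  have hρ2 : ∀ t, x t^2 + y t^2 = δ^2 * ρ t^2 := fun t => by
    rw [← mul_pow, ← hρr, Real.sq_sqrt (hpos t).le]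
  have hxρ : ∀ t, x t = δ * ρ t * cos (θ t) := fun t => by rw [← hρr]; exact hxθ t
  have hyρ : ∀ t, y t = δ * ρ t * sin (θ t) := fun t => by rw [← hρr]; exact hyθ t
  have hρpos : ∀ t, 0 < ρ t := fun t => div_pos (Real.sqrt_pos.2 (hpos t)) hδ
  have hρI : ∀ t, ρ t ∈ Icc (1/2:ℝ) 2 := by
    intro t
    have h1 : δ^2/4 < x t^2 + y t^2 := (hU t).1
    have h2 : x t^2 + y t^2 < 4 * δ^2 := (hU t).2
    rw [hρ2] at h1 h2
    have h3 : (0:ℝ) < δ^2 := by positivity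
    have h1' : 1/4 < ρ t^2 := by nlinarith
    have h2' : ρ t^2 < 4 := by nlinarith
    constructor <;> nlinarith [hρpos t]
  have hDpos : ∀ t, 1/2 ≤ kkD δ α β γ (ρ t) (cos (θ t)) (sin (θ t)) := fun t =>
    (H _ _ (hcs _) (hsn _) _ (hρI t)).1
  have hqρ : ∀ t, q t = δ * ρ t * (cos (θ t) + δ * kkQ δ α β γ (ρ t) (cos (θ t)) (sin (θ t))) := by
    intro t
    simp only [q]
    rw [hρ2, hxρ, hyρ]
    unfold kkQ
    ring
  have hθ' : ∀ t, HasDerivAt θ (kkD δ α β γ (ρ t) (cos (θ t)) (sin (θ t))) t := by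
    intro t
    refine (hθ t).congr_deriv ?_
    rw [hqρ, hρ2, hxρ, hyρ, div_eq_iff (by have := hρpos t; positivity)]
    unfold kkD
    linear_combination δ^2 * ρ t^2 * sin_sq_add_cos_sq (θ t)
  have hρ' : ∀ t, HasDerivAt ρ (kkF δ α β γ (ρ t) (cos (θ t)) (sin (θ t)) *
      kkD δ α β γ (ρ t) (cos (θ t)) (sin (θ t))) t := by
    intro t
    have h1 := ((((hx t).pow 2).add ((hy t).pow 2)).sqrt (hpos t).ne').div_const δ
    refine h1.congr_deriv ?_
    have h2 : √((x ^ 2 + y ^ 2) t) = δ * ρ t := hρr t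
    have h3 := (hρpos t).ne'
    have h4 : kkD δ α β γ (ρ t) (cos (θ t)) (sin (θ t)) ≠ 0 := by linarith [hDpos t]
    rw [h2, hqρ, hxρ, hyρ]
    unfold kkF
    field_simp
    push_cast
    ring
  let W : ℝ → ℝ := fun t =>
    (Real.log (ρ t) + δ * kkp δ α β γ (ρ t) (cos (θ t)) (sin (θ t))) -
    (Real.log (R (θ t)) + δ * kkp δ α β γ (R (θ t)) (cos (θ t)) (sin (θ t)))
  have hRI' : ∀ φ, R φ ∈ Icc (1/2:ℝ) 2 := fun φ => Ioo_subset_Icc_self (hRI φ)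
  have hW : ∀ t, HasDerivAt W
      (δ^2 * kkM δ α β γ (ρ t) (cos (θ t)) (sin (θ t)) * kkD δ α β γ (ρ t) (cos (θ t)) (sin (θ t)) -
       δ^2 * kkM δ α β γ (R (θ t)) (cos (θ t)) (sin (θ t)) *
        kkD δ α β γ (ρ t) (cos (θ t)) (sin (θ t))) t := by
    intro t
    refine (kk_deriv_W δ α β γ ρ θ _ t (hθ' t) (hρ' t) (hρpos t) (by linarith [hDpos t])).sub ?_
    refine kk_deriv_W δ α β γ (fun t => R (θ t)) θ _ t (hθ' t) ?_ (by linarith [(hRI (θ t)).1]) ?_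
    · exact (hR (θ t)).comp t (hθ' t)
    · have := (H _ _ (hcs (θ t)) (hsn (θ t)) _ (hRI' (θ t))).1
      linarith
  have hsign : ∀ t, (ρ t < R (θ t) ∨ R (θ t) < ρ t) →
      2 * W t * (δ^2 * kkM δ α β γ (ρ t) (cos (θ t)) (sin (θ t)) *
        kkD δ α β γ (ρ t) (cos (θ t)) (sin (θ t)) -
       δ^2 * kkM δ α β γ (R (θ t)) (cos (θ t)) (sin (θ t)) *
        kkD δ α β γ (ρ t) (cos (θ t)) (sin (θ t))) < 0 := by
    intro t ht
    have hD := hDpos t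
    have hDδ : 0 < δ^2 * kkD δ α β γ (ρ t) (cos (θ t)) (sin (θ t)) :=
      mul_pos (by positivity) (by linarith)
    have hfac : ∀ A B D : ℝ, δ^2 * A * D - δ^2 * B * D = (A - B) * (δ^2 * D) := by
      intros; ring
    rw [hfac]
    rcases ht with ht | ht
    · obtain ⟨h1, h2⟩ := ((H _ _ (hcs (θ t)) (hsn (θ t)) _ (hρI t)).2.2.2.2 _ (hRI' (θ t))).2 ht
      have hWn : W t < 0 := by simp only [W]; linarith
      exact mul_neg_of_neg_of_pos (by linarith) (mul_pos (by linarith) hDδ)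
    · obtain ⟨h1, h2⟩ := ((H _ _ (hcs (θ t)) (hsn (θ t)) _ (hRI' (θ t))).2.2.2.2 _ (hρI t)).2 ht
      have hWn : 0 < W t := by simp only [W]; linarith
      exact mul_neg_of_pos_of_neg (by linarith) (mul_neg_of_neg_of_pos (by linarith) hDδ)
  have hW2 : ∀ t, HasDerivAt (fun t => W t ^ 2)
      (2 * W t * (δ^2 * kkM δ α β γ (ρ t) (cos (θ t)) (sin (θ t)) *
        kkD δ α β γ (ρ t) (cos (θ t)) (sin (θ t)) -
       δ^2 * kkM δ α β γ (R (θ t)) (cos (θ t)) (sin (θ t)) *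
        kkD δ α β γ (ρ t) (cos (θ t)) (sin (θ t)))) t := by
    intro t
    refine ((hW t).pow 2).congr_deriv ?_
    push_cast
    ring
  have hanti : Antitone (fun t => W t ^ 2) := by
    refine antitone_of_hasDerivAt_nonpos hW2 ?_
    intro t
    simp only [Pi.zero_apply]
    rcases lt_trichotomy (ρ t) (R (θ t)) with h | h | h
    · exact (hsign t (Or.inl h)).le
    · have : W t = 0 := by simp only [W]; rw [h]; ring
      rw [this]; simp
    · exact (hsign t (Or.inr h)).le
  obtain ⟨T, hT, hgT⟩ := hp
  have hWper : ∀ t, W (t + T) = W t := by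
    intro t
    have e1 : x (t + T) = x t := by simp only [x, hgT]
    have e2 : y (t + T) = y t := by simp only [y, hgT]
    have e3 : ρ (t + T) = ρ t := by simp only [ρ, e1, e2]
    have hne : δ * ρ t ≠ 0 := (mul_pos hδ (hρpos t)).ne'
    have e4 : cos (θ (t + T)) = cos (θ t) := by
      have h1 := hxρ (t + T)
      rw [e1, e3, hxρ t] at h1
      exact (mul_left_cancel₀ hne h1).symm
    have e5 : sin (θ (t + T)) = sin (θ t) := by
      have h1 := hyρ (t + T)
      rw [e2, e3, hyρ t] at h1
      exact (mul_left_cancel₀ hne h1).symm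
    obtain ⟨k, hk⟩ := Real.Angle.angle_eq_iff_two_pi_dvd_sub.1 (Real.Angle.cos_sin_inj e4 e5)
    have e6 : R (θ (t + T)) = R (θ t) := by
      have h1 : θ (t + T) = θ t + k * (2*π) := by linarith
      rw [h1]
      exact hRper.int_mul k (θ t)
    simp only [W, e3, e4, e5, e6]
  have hconst : ∀ t, ρ t = R (θ t) := by
    intro t
    by_contra hne
    have hneg := hsign t (lt_or_gt_of_ne hne)
    have hcst : ∀ u ∈ Icc t (t + T), W u ^ 2 = W t ^ 2 := by
      intro u hu
      have h1 : W u ^ 2 ≤ W t ^ 2 := hanti hu.1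
      have h2 : W (t + T) ^ 2 ≤ W u ^ 2 := hanti hu.2
      rw [hWper] at h2
      exact le_antisymm h1 h2
    have hd1 := (hW2 t).hasDerivWithinAt (s := Ici t)
    have hd2 : HasDerivWithinAt (fun t => W t ^ 2) 0 (Ici t) t := by
      refine (hasDerivWithinAt_const t (Ici t) (W t ^ 2)).congr_of_eventuallyEq ?_ rfl
      filter_upwards [Icc_mem_nhdsGE (show t < t + T by linarith)] with u hu
      exact hcst u hu
    have := (uniqueDiffWithinAt_Ici t).eq_deriv _ hd1 hd2
    linarith
  have hsurj : Function.Surjective θ := kk_surj θ _ hθ' (1/2) (by norm_num) hDpos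
  have hgθ : ∀ t, g t = (δ * R (θ t) * cos (θ t), δ * R (θ t) * sin (θ t)) := by
    intro t
    rw [← hconst]
    exact Prod.ext (hxρ t) (hyρ t)
  ext p
  constructor
  · rintro ⟨t, rfl⟩
    exact ⟨θ t, (hgθ t).symm⟩
  · rintro ⟨φ, rfl⟩
    obtain ⟨t, rfl⟩ := hsurj φ
    exact ⟨t, hgθ t⟩

/-- For every `r > 0` there is a nonempty open set `N ⊂ ℝ³` of
parameters such that for every `(a,b,c) ∈ N` the Kukles system has a
small-amplitude limit cycle contained in the open ball of radius `r` about the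
origin: a nonconstant periodic solution with image `Γ ⊆ {x² + y² < r²}` and an
open neighborhood `U` of `Γ` such that every nonconstant periodic solution with
image contained in `U` has image equal to `Γ`. -/
theorem kukles_small_amplitude_limit_cycle (r : ℝ) (hr : 0 < r) :
    ∃ N : Set (ℝ × ℝ × ℝ), IsOpen N ∧ N.Nonempty ∧
      ∀ μ ∈ N,
        ∃ γ : ℝ → ℝ × ℝ,
          IsKuklesSol μ.1 μ.2.1 μ.2.2 γ ∧ IsPeriodicCurve γ ∧ IsNonconstCurve γ ∧
          Set.range γ ⊆ {p : ℝ × ℝ | p.1 ^ 2 + p.2 ^ 2 < r ^ 2} ∧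
          ∃ U : Set (ℝ × ℝ), IsOpen U ∧ Set.range γ ⊆ U ∧
            ∀ γ' : ℝ → ℝ × ℝ, IsKuklesSol μ.1 μ.2.1 μ.2.2 γ' → IsPeriodicCurve γ' →
              IsNonconstCurve γ' → Set.range γ' ⊆ U →
                Set.range γ' = Set.range γ := by
  have hpi := Real.pi_pos
  obtain ⟨δ₀, hδ₀, -, L, hL, HB⟩ := kk_bounds
  obtain ⟨δ, hδ, hδlt, hδr⟩ : ∃ δ : ℝ, 0 < δ ∧ δ < δ₀ ∧ 2 * δ ≤ r := by
    refine ⟨min δ₀ r / 2, by positivity, ?_, ?_⟩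
    · linarith [min_le_left δ₀ r]
    · linarith [min_le_right δ₀ r]
  have hδ2 : 0 < δ^2 := by positivity
  refine ⟨Set.Ioo (9/10) (11/10) ×ˢ (Set.Ioo (9/10) (11/10) ×ˢ
    Set.Ioo (-3/10 * δ^2) (-2/10 * δ^2)),
    isOpen_Ioo.prod (isOpen_Ioo.prod isOpen_Ioo), ⟨(1, 1, -1/4 * δ^2), ?_⟩, ?_⟩
  · refine ⟨⟨by norm_num, by norm_num⟩, ⟨by norm_num, by norm_num⟩, ?_, ?_⟩ <;>
      simp only <;> nlinarith
  rintro ⟨α, β, κ⟩ ⟨⟨hα1, hα2⟩, ⟨hβ1, hβ2⟩, hκ1, hκ2⟩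
  simp only at hα1 hα2 hβ1 hβ2 hκ1 hκ2 ⊢
  obtain ⟨γ, rfl⟩ : ∃ γ, κ = δ^2 * γ := ⟨κ / δ^2, by field_simp⟩
  have hγ1 : -3/10 < γ := by nlinarith
  have hγ2 : γ < -2/10 := by nlinarith
  have H : KKGood δ α β γ L := HB δ α β γ hδ hδlt hα1 hα2 hβ1 hβ2 hγ1 hγ2
  obtain ⟨R, hRI, hRper, hR⟩ := kk_exists_R δ α β γ L hδ hL H
  have hRc : Continuous R := continuous_iff_continuousAt.2 fun t => (hR t).continuousAt
  have hDpos : ∀ θ, 1/2 ≤ kkD δ α β γ (R θ) (Real.cos θ) (Real.sin θ) := fun θ =>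
    (H _ _ (Real.abs_cos_le_one θ) (Real.abs_sin_le_one θ) _ (Set.Ioo_subset_Icc_self (hRI θ))).1
  obtain ⟨φ, hφ, hsurj, T, hT, hφT⟩ := kk_time
    (fun θ => kkD δ α β γ (R θ) (Real.cos θ) (Real.sin θ))
    (by unfold kkD kkQ; fun_prop)
    (by
      intro θ
      simp only [hRper θ, Real.cos_add_two_pi, Real.sin_add_two_pi])
    hDpos
  have hnorm : ∀ θ, (δ * R θ * Real.cos θ)^2 + (δ * R θ * Real.sin θ)^2 = δ^2 * R θ^2 := by
    intro θ
    linear_combination δ^2 * R θ^2 * Real.sin_sq_add_cos_sq θ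
  have hR2 : ∀ θ, 1/4 < R θ^2 ∧ R θ^2 < 4 := by
    intro θ
    obtain ⟨h1, h2⟩ := hRI θ
    constructor <;> nlinarith
  let P : ℝ → ℝ × ℝ := fun θ => (δ * R θ * Real.cos θ, δ * R θ * Real.sin θ)
  have hPU : ∀ θ, δ^2/4 < (P θ).1^2 + (P θ).2^2 ∧ (P θ).1^2 + (P θ).2^2 < 4 * δ^2 := by
    intro θ
    simp only [P, hnorm]
    obtain ⟨h1, h2⟩ := hR2 θ
    constructor <;> nlinarith
  have hrange : Set.range (fun t => P (φ t)) = Set.range P := hsurj.range_comp P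
  refine ⟨fun t => P (φ t), ?_, ⟨T, hT, ?_⟩, ?_, ?_,
    {p : ℝ × ℝ | δ^2/4 < p.1^2 + p.2^2 ∧ p.1^2 + p.2^2 < 4 * δ^2}, ?_, ?_, ?_⟩
  · intro t
    have hRφ := (hR (φ t)).comp t (hφ t)
    have hx := (hRφ.const_mul δ).mul (hφ t).cos
    have hy := (hRφ.const_mul δ).mul (hφ t).sin
    have hD : kkD δ α β γ (R (φ t)) (Real.cos (φ t)) (Real.sin (φ t)) ≠ 0 := by
      linarith [hDpos (φ t)]
    have hFD : kkF δ α β γ (R (φ t)) (Real.cos (φ t)) (Real.sin (φ t)) *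
        kkD δ α β γ (R (φ t)) (Real.cos (φ t)) (Real.sin (φ t)) =
        δ * R (φ t) * Real.sin (φ t) *
          kkQ δ α β γ (R (φ t)) (Real.cos (φ t)) (Real.sin (φ t)) := by
      unfold kkF
      field_simp
    refine (hx.prodMk hy).congr_deriv ?_
    simp only [P, hnorm, Function.comp]
    rw [hFD]
    refine Prod.ext ?_ ?_
    · simp only [kkD]
      ring
    · simp only [kkD]
      have hQ : kkQ δ α β γ (R (φ t)) (Real.cos (φ t)) (Real.sin (φ t)) =
        -Real.sin (φ t) * (1 - δ^2*R (φ t)^2) *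
          (R (φ t) * (α*Real.cos (φ t) + β*Real.sin (φ t)) + δ*γ) := rfl
      linear_combination (δ^2 * R (φ t)) * hQ +
        (δ^2 * R (φ t) * kkQ δ α β γ (R (φ t)) (Real.cos (φ t)) (Real.sin (φ t))) *
          Real.sin_sq_add_cos_sq (φ t)
  · intro t
    simp only [P, hφT, hRper (φ t), Real.cos_add_two_pi, Real.sin_add_two_pi]
  · obtain ⟨t, ht⟩ := hsurj 0
    obtain ⟨s, hs⟩ := hsurj Real.pi
    refine ⟨t, s, fun h => ?_⟩
    have h1 := congrArg Prod.fst h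
    simp only [P, ht, hs, Real.cos_zero, Real.cos_pi] at h1
    have h2 := mul_pos hδ (show 0 < R 0 by linarith [(hRI 0).1])
    have h3 := mul_pos hδ (show 0 < R Real.pi by linarith [(hRI Real.pi).1])
    linarith
  · rintro _ ⟨t, rfl⟩
    have h1 := (hPU (φ t)).2
    change (P (φ t)).1^2 + (P (φ t)).2^2 < r^2
    nlinarith
  · have hc : Continuous fun p : ℝ × ℝ => p.1^2 + p.2^2 := by fun_prop
    exact (isOpen_lt continuous_const hc).inter (isOpen_lt hc continuous_const)
  · rintro _ ⟨t, rfl⟩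
    exact hPU (φ t)
  · intro g hg hp _ hU
    rw [hrange]
    exact kk_unique δ α β γ L hδ H R hRI hRper hR g hg hp fun t => hU ⟨t, rfl⟩
end

section
/- The Kukles system (K) has a center at the origin if and only if c = 0 and (a = 0 or b = 0). Here the origin is a center means: there exists an open neighborhood U of (0,0) such that every point p ∈ U with p ≠ (0,0) lies on the image of a nonconstant periodic solution of (K). -/
open Set Filter Topology

/-- Lyapunov-type lemma: a periodic curve along which `F` is nonincreasing near the origin. -/
lemma lyap_aux (γ : ℝ → ℝ × ℝ) (F D : ℝ × ℝ → ℝ) (δ T : ℝ) (hγ : Continuous γ)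
    (hT : 0 < T) (hper : ∀ t, γ (t + T) = γ t)
    (hd : ∀ t, HasDerivAt (fun t => F (γ t)) (D (γ t)) t)
    (hD : ∀ q : ℝ × ℝ, ‖q‖ ≤ δ → D q ≤ 0)
    (h0 : ‖γ 0‖ < δ) (hF : ∀ q : ℝ × ℝ, ‖q‖ = δ → F (γ 0) < F q) :
    ∀ t, ‖γ t‖ ≤ δ ∧ D (γ t) = 0 := by
  have hanti : ∀ τ, 0 ≤ τ → (∀ t ∈ Icc 0 τ, ‖γ t‖ ≤ δ) →
      AntitoneOn (fun t => F (γ t)) (Icc 0 τ) := by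
    intro τ hτ h
    apply antitoneOn_of_deriv_nonpos (convex_Icc _ _)
    · exact fun t _ => (hd t).continuousAt.continuousWithinAt
    · exact fun t _ => (hd t).differentiableAt.differentiableWithinAt
    · intro t ht
      rw [interior_Icc] at ht
      rw [(hd t).deriv]
      exact hD _ (h t ⟨ht.1.le, ht.2.le⟩)
  have hin : ∀ t, 0 ≤ t → ‖γ t‖ < δ := by
    by_contra! hcon
    obtain ⟨t₁, ht₁, hb⟩ := hcon
    let S : Set ℝ := Ici 0 ∩ {t | δ ≤ ‖γ t‖}
    have hS : IsClosed S := isClosed_Ici.inter (isClosed_le continuous_const hγ.norm)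
    have hne : S.Nonempty := ⟨t₁, ht₁, hb⟩
    have hbd : BddBelow S := ⟨0, fun t ht => ht.1⟩
    have hm : sInf S ∈ S := hS.csInf_mem hne hbd
    set τ := sInf S with hτ
    have hlt : ∀ t, 0 ≤ t → t < τ → ‖γ t‖ < δ := by
      intro t h1 h2
      by_contra! h3
      exact absurd (csInf_le hbd (show t ∈ S from ⟨h1, h3⟩)) (not_le.2 h2)
    obtain ⟨s, hs, hse⟩ := intermediate_value_Icc (f := fun t => ‖γ t‖) hm.1
      hγ.norm.continuousOn ⟨h0.le, hm.2⟩
    have hsτ : s = τ := by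
      rcases lt_or_eq_of_le hs.2 with h | h
      · exact absurd hse (hlt s hs.1 h).ne
      · exact h
    clear_value τ
    subst hsτ
    have := hanti s hm.1 (fun t ht => by
      rcases lt_or_eq_of_le ht.2 with h | h
      · exact (hlt t ht.1 h).le
      · rw [h]; exact hse.le)
    have h2 := this ⟨le_rfl, hm.1⟩ ⟨hm.1, le_rfl⟩ hm.1
    have h3 := hF _ hse
    simp only at h2
    linarith
  have hperN : ∀ (n : ℕ) t, γ (t + n * T) = γ t := by
    intro n
    induction n with
    | zero => intro t; simp
    | succ k ih => 
      intro t
      rw [← ih t, ← hper (t + k * T)]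
      congr 1; push_cast; ring
  have hconst : ∀ t, 0 ≤ t → F (γ t) = F (γ 0) := by
    intro t ht
    obtain ⟨n, hn⟩ := exists_nat_ge (t / T)
    have hn' : t ≤ n * T := by rwa [div_le_iff₀ hT] at hn
    have ha := hanti (n * T) (ht.trans hn') (fun s hs => (hin s hs.1).le)
    have h1 := ha ⟨le_rfl, ht.trans hn'⟩ ⟨ht, hn'⟩ ht
    have h2 := ha ⟨ht, hn'⟩ ⟨ht.trans hn', le_rfl⟩ hn'
    have h3 := hperN n 0
    rw [zero_add] at h3
    simp only [h3] at h1 h2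
    linarith
  have hpos : ∀ t, 0 < t → D (γ t) = 0 := by
    intro t ht
    have h1 : (fun t => F (γ t)) =ᶠ[𝓝 t] fun _ => F (γ 0) := by
      filter_upwards [lt_mem_nhds ht] with s hs using hconst s hs.le
    exact (hd t).unique ((hasDerivAt_const t (F (γ 0))).congr_of_eventuallyEq h1)
  intro t
  obtain ⟨n, hn⟩ := exists_nat_gt (-t / T)
  have hn' : -t < n * T := by rwa [div_lt_iff₀ hT] at hn
  rw [← hperN n t]
  exact ⟨(hin _ (by linarith)).le, hpos _ (by linarith)⟩

lemma lyap (γ : ℝ → ℝ × ℝ) (F D : ℝ × ℝ → ℝ) (δ : ℝ) (hγ : Continuous γ)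
    (hper : IsPeriodicCurve γ)
    (hd : ∀ t, HasDerivAt (fun t => F (γ t)) (D (γ t)) t)
    (hD : (∀ q : ℝ × ℝ, ‖q‖ ≤ δ → D q ≤ 0) ∨ (∀ q : ℝ × ℝ, ‖q‖ ≤ δ → 0 ≤ D q))
    (t₀ : ℝ) (h0 : ‖γ t₀‖ < δ) (hF : ∀ q : ℝ × ℝ, ‖q‖ = δ → F (γ t₀) < F q) :
    ∀ t, ‖γ t‖ ≤ δ ∧ D (γ t) = 0 := by
  obtain ⟨T, hT, hp⟩ := hper
  intro t
  rcases hD with hD | hD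
  · have := lyap_aux (fun t => γ (t + t₀)) F D δ T (by fun_prop) hT
      (fun t => by rw [← hp (t + t₀)]; congr 1; ring)
      (fun t => (hd (t + t₀)).comp_add_const t t₀) hD (by simpa using h0) (by simpa using hF)
      (t - t₀)
    simpa using this
  · have := lyap_aux (fun t => γ (t₀ - t)) F (fun q => - D q) δ T (by fun_prop) hT
      (fun t => by rw [← hp (t₀ - (t + T))]; congr 1; ring)
      (fun t => (hd (t₀ - t)).comp_const_sub t₀ t) (fun q hq => by linarith [hD q hq])
      (by simpa using h0) (by simpa using hF) (t₀ - t)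
    simpa using this

lemma sol_comp {a b c : ℝ} {γ : ℝ → ℝ × ℝ} (h : IsKuklesSol a b c γ) (t : ℝ) :
    HasDerivAt (fun t => (γ t).1) (-(γ t).2) t ∧
    HasDerivAt (fun t => (γ t).2) ((γ t).1 + (γ t).2 * ((γ t).1 ^ 2 + (γ t).2 ^ 2 - 1) *
        (a * (γ t).1 + b * (γ t).2 + c)) t :=
  ⟨(h t).fst, (h t).snd⟩

/-- General obstruction from a Lyapunov function. -/
lemma not_center {a b c : ℝ} (F D : ℝ × ℝ → ℝ) (δ m : ℝ) (hδ : 0 < δ) (hm : 0 < m)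
    (hFc : Continuous F) (hF0 : F (0, 0) = 0)
    (hd : ∀ γ, IsKuklesSol a b c γ → ∀ t, HasDerivAt (fun t => F (γ t)) (D (γ t)) t)
    (hD : (∀ q : ℝ × ℝ, ‖q‖ ≤ δ → D q ≤ 0) ∨ (∀ q : ℝ × ℝ, ‖q‖ ≤ δ → 0 ≤ D q))
    (hF : ∀ q : ℝ × ℝ, ‖q‖ = δ → m ≤ F q)
    (hz : ∀ q : ℝ × ℝ, ‖q‖ ≤ δ → D q = 0 → q.2 = 0)
    (hU : ∃ U : Set (ℝ × ℝ), IsOpen U ∧ ((0:ℝ), (0:ℝ)) ∈ U ∧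
        ∀ p ∈ U, p ≠ ((0:ℝ), (0:ℝ)) →
          ∃ γ : ℝ → ℝ × ℝ, IsKuklesSol a b c γ ∧ IsPeriodicCurve γ ∧
            IsNonconstCurve γ ∧ p ∈ Set.range γ) : False := by
  obtain ⟨U, hUo, h0U, hU⟩ := hU
  have e1 : ∀ᶠ q in 𝓝 ((0:ℝ), (0:ℝ)), q ∈ U ∧ F q < m ∧ ‖q‖ < δ := by
    refine Filter.Eventually.and (hUo.mem_nhds h0U) (Filter.Eventually.and ?_ ?_)
    · exact hFc.continuousAt.eventually_lt continuousAt_const (by rw [hF0]; exact hm)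
    · exact continuous_norm.continuousAt.eventually_lt continuousAt_const (by simpa using hδ)
  have hc : Tendsto (fun ε : ℝ => (ε, (0:ℝ))) (𝓝[>] 0) (𝓝 (0, 0)) := by
    have : Continuous (fun ε : ℝ => (ε, (0:ℝ))) := by fun_prop
    exact (this.tendsto 0).mono_left nhdsWithin_le_nhds
  obtain ⟨ε, ⟨h1, h2, h3⟩, hε⟩ := ((hc.eventually e1).and self_mem_nhdsWithin).exists
  have hε' : (0:ℝ) < ε := hε
  obtain ⟨γ, hs, hp, ⟨t, s, hts⟩, t₀, ht₀⟩ := hU _ h1 (by simp [hε'.ne'])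
  have hγ : Continuous γ := continuous_iff_continuousAt.2 fun t => (hs t).continuousAt
  have key := lyap γ F D δ hγ hp (hd γ hs) hD t₀ (by rwa [ht₀])
    (fun q hq => by rw [ht₀]; exact h2.trans_le (hF q hq))
  have hy : ∀ t, (γ t).2 = 0 := fun t => hz _ (key t).1 (key t).2
  have hx : ∀ t, (γ t).1 = 0 := by
    intro t
    have h := (sol_comp hs t).2
    simp only [hy] at h
    have := h.unique (hasDerivAt_const t (0:ℝ))
    simpa using this
  exact hts (Prod.ext ((hx t).trans (hx s).symm) ((hy t).trans (hy s).symm))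

lemma abs_le_of_norm {q : ℝ × ℝ} {δ : ℝ} (h : ‖q‖ ≤ δ) : |q.1| ≤ δ ∧ |q.2| ≤ δ := by
  simpa [Prod.norm_def] using h

lemma sq_norm_le (q : ℝ × ℝ) : ‖q‖ ^ 2 ≤ q.1 ^ 2 + q.2 ^ 2 := by
  rw [Prod.norm_def]
  rcases max_cases ‖q.1‖ ‖q.2‖ with h | h <;> rw [h.1] <;> simp <;> positivity

lemma necc_c {a b c : ℝ} (hc : c ≠ 0)
    (hU : ∃ U : Set (ℝ × ℝ), IsOpen U ∧ ((0:ℝ), (0:ℝ)) ∈ U ∧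
        ∀ p ∈ U, p ≠ ((0:ℝ), (0:ℝ)) →
          ∃ γ : ℝ → ℝ × ℝ, IsKuklesSol a b c γ ∧ IsPeriodicCurve γ ∧
            IsNonconstCurve γ ∧ p ∈ Set.range γ) : False := by
  have hcp : 0 < |c| := abs_pos.2 hc
  set A := |a| + |b| with hA
  have hA0 : 0 ≤ A := by positivity
  obtain ⟨δ, hδ, hδ1, hδ2⟩ : ∃ δ : ℝ, 0 < δ ∧ δ ≤ 1/2 ∧ A * δ ≤ |c| / 2 := by
    refine ⟨min (1/2) (|c| / (2 * (A + 1))), by positivity, min_le_left _ _, ?_⟩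
    calc A * min (1/2) (|c| / (2 * (A + 1))) ≤ (A + 1) * (|c| / (2 * (A + 1))) := by
          gcongr
          · linarith
          · exact min_le_right _ _
      _ = |c| / 2 := by field_simp
  have hlin : ∀ q : ℝ × ℝ, ‖q‖ ≤ δ → |a * q.1 + b * q.2| ≤ |c| / 2 := by
    intro q hq
    obtain ⟨h1, h2⟩ := abs_le_of_norm hq
    calc |a * q.1 + b * q.2| ≤ |a| * |q.1| + |b| * |q.2| := by
          rw [← abs_mul, ← abs_mul]; exact abs_add_le _ _
      _ ≤ |a| * δ + |b| * δ := by gcongr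
      _ = A * δ := by rw [hA]; ring
      _ ≤ _ := hδ2
  have hr : ∀ q : ℝ × ℝ, ‖q‖ ≤ δ → q.1 ^ 2 + q.2 ^ 2 - 1 < 0 := by
    intro q hq
    obtain ⟨h1, h2⟩ := abs_le_of_norm hq
    have h3 : q.1 ^ 2 ≤ (1/2) ^ 2 := sq_le_sq' (by linarith [(abs_le.1 h1).1]) (by linarith [(abs_le.1 h1).2])
    have h4 : q.2 ^ 2 ≤ (1/2) ^ 2 := sq_le_sq' (by linarith [(abs_le.1 h2).1]) (by linarith [(abs_le.1 h2).2])
    linarith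
  have hlc : ∀ q : ℝ × ℝ, ‖q‖ ≤ δ → a * q.1 + b * q.2 + c ≠ 0 := by
    intro q hq h
    have h1 := hlin q hq
    have : a * q.1 + b * q.2 = - c := by linarith
    rw [this, abs_neg] at h1
    linarith
  refine not_center (fun q => (q.1 ^ 2 + q.2 ^ 2) / 2)
    (fun q => q.2 ^ 2 * ((q.1 ^ 2 + q.2 ^ 2 - 1) * (a * q.1 + b * q.2 + c))) δ (δ ^ 2 / 2) hδ
    (by positivity) (by fun_prop) (by simp) ?_ ?_ ?_ ?_ hU
  · intro γ hs t
    obtain ⟨h1, h2⟩ := sol_comp hs t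
    convert! ((h1.pow 2).add (h2.pow 2)).div_const 2 using 1
    simp only [Nat.cast_ofNat]
    ring
  · rcases lt_or_gt_of_ne hc with h | h
    · right
      intro q hq
      have h1 := (abs_le.1 (hlin q hq)).2
      rw [abs_of_neg h] at h1
      exact mul_nonneg (sq_nonneg _) (mul_nonneg_of_nonpos_of_nonpos (hr q hq).le (by linarith))
    · left
      intro q hq
      have h1 := (abs_le.1 (hlin q hq)).1
      rw [abs_of_pos h] at h1
      exact mul_nonpos_of_nonneg_of_nonpos (sq_nonneg _)
        (mul_nonpos_of_nonpos_of_nonneg (hr q hq).le (by linarith))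
  · intro q hq
    have := sq_norm_le q
    rw [hq] at this
    linarith
  · intro q hq h
    have := mul_ne_zero (hr q hq).ne (hlc q hq)
    have h2 := (mul_eq_zero.1 h).resolve_right this
    exact pow_eq_zero_iff (two_ne_zero) |>.1 h2

lemma necc_ab_bounds (a b x y ρ A : ℝ) (hA : A = |a| + |b|) (hρ : 0 ≤ ρ) (hρ1 : ρ ≤ 1)
    (hx : |x| ≤ ρ) (hy : |y| ≤ ρ) :
    |a * y ^ 3 / 3 - b * (x * y ^ 2 + 2 * x ^ 3 / 3)
      + (a * b * (-(x ^ 3 * y) / 8 - 7 * (x * y ^ 3) / 8) - (2 * b ^ 2 - a ^ 2) * y ^ 4 / 4)|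
      ≤ (2 * A + 2 * A ^ 2) * ρ ^ 3 ∧
    |(a * b * (-(x ^ 3) / 8 - 21 * (x * y ^ 2) / 8) - (2 * b ^ 2 - a ^ 2) * y ^ 3) *
        (-(a * x * y) - b * y ^ 2) +
      (y + (a * y ^ 2 - 2 * b * x * y) +
        (a * b * (-(x ^ 3) / 8 - 21 * (x * y ^ 2) / 8) - (2 * b ^ 2 - a ^ 2) * y ^ 3)) *
        (y * (x ^ 2 + y ^ 2) * (a * x + b * y))|
      ≤ (15 * A ^ 3 + 4 * A ^ 2 + 2 * A) * ρ ^ 5 := by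
  have ha : |a| ≤ A := by rw [hA]; linarith [abs_nonneg b]
  have hb : |b| ≤ A := by rw [hA]; linarith [abs_nonneg a]
  have hA0 : 0 ≤ A := (abs_nonneg a).trans ha
  have hm : ∀ i j : ℕ, |x ^ i * y ^ j| ≤ ρ ^ (i + j) := by
    intro i j
    rw [abs_mul, abs_pow, abs_pow, pow_add]
    gcongr
  have hmul : ∀ {u v M N : ℝ}, |u| ≤ M → |v| ≤ N → |u * v| ≤ M * N := by
    intro u v M N h1 h2
    rw [abs_mul]
    exact mul_le_mul h1 h2 (abs_nonneg _) ((abs_nonneg _).trans h1)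
  have hadd : ∀ {u v M N : ℝ}, |u| ≤ M → |v| ≤ N → |u + v| ≤ M + N := by
    intro u v M N h1 h2
    exact (abs_add_le _ _).trans (add_le_add h1 h2)
  have hab : |a * b| ≤ A * A := hmul ha hb
  have hbb : |2 * b ^ 2 - a ^ 2| ≤ 2 * A ^ 2 := by
    have h1 : b ^ 2 ≤ A ^ 2 := sq_le_sq' (by linarith [(abs_le.1 hb).1]) (abs_le.1 hb).2
    have h2 : a ^ 2 ≤ A ^ 2 := sq_le_sq' (by linarith [(abs_le.1 ha).1]) (abs_le.1 ha).2
    rw [abs_le]; constructor <;> nlinarith [sq_nonneg a, sq_nonneg b]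
  have p1 : |y ^ 3| ≤ ρ ^ 3 := by simpa using hm 0 3
  have p2 : |x * y ^ 2| ≤ ρ ^ 3 := by simpa using hm 1 2
  have p3 : |x ^ 3| ≤ ρ ^ 3 := by simpa using hm 3 0
  have p4 : |x ^ 3 * y| ≤ ρ ^ 4 := by simpa using hm 3 1
  have p5 : |x * y ^ 3| ≤ ρ ^ 4 := by simpa using hm 1 3
  have p6 : |y ^ 4| ≤ ρ ^ 4 := by simpa using hm 0 4
  have p7 : |x * y| ≤ ρ ^ 2 := by simpa using hm 1 1
  have p8 : |y ^ 2| ≤ ρ ^ 2 := by simpa using hm 0 2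
  have p9 : |x ^ 2| ≤ ρ ^ 2 := by simpa using hm 2 0
  have hF4y : |a * b * (-(x ^ 3) / 8 - 21 * (x * y ^ 2) / 8) - (2 * b ^ 2 - a ^ 2) * y ^ 3|
      ≤ 5 * A ^ 2 * ρ ^ 3 := by
    have q1 : |-(x ^ 3) / 8 - 21 * (x * y ^ 2) / 8| ≤ 22 / 8 * ρ ^ 3 := by
      rw [abs_le] at p2 p3 ⊢; constructor <;> linarith
    have q2 := hmul hab q1
    have q3 := hmul hbb p1
    have : 0 ≤ A ^ 2 * ρ ^ 3 := by positivity
    rw [abs_le] at q2 q3 ⊢; constructor <;> linarith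
  have hQ : |-(a * x * y) - b * y ^ 2| ≤ A * ρ ^ 2 := by
    have q1 : |a * (x * y)| ≤ |a| * ρ ^ 2 := hmul le_rfl p7
    have q2 : |b * y ^ 2| ≤ |b| * ρ ^ 2 := hmul le_rfl p8
    rw [hA]
    rw [abs_le] at q1 q2 ⊢; constructor <;> linarith
  have hlin : |a * x + b * y| ≤ A * ρ := by
    have q1 : |a * x| ≤ |a| * ρ := hmul le_rfl hx
    have q2 : |b * y| ≤ |b| * ρ := hmul le_rfl hy
    have := hadd q1 q2
    rw [hA]; linarith
  have hN : |y * (x ^ 2 + y ^ 2) * (a * x + b * y)| ≤ ρ * (ρ ^ 2 + ρ ^ 2) * (A * ρ) :=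
    hmul (hmul hy (hadd p9 p8)) hlin
  have hF3y : |a * y ^ 2 - 2 * b * x * y| ≤ 2 * A * ρ ^ 2 := by
    have q1 : |a * y ^ 2| ≤ |a| * ρ ^ 2 := hmul le_rfl p8
    have q2 : |b * (x * y)| ≤ |b| * ρ ^ 2 := hmul le_rfl p7
    have : 0 ≤ |a| * ρ ^ 2 := by positivity
    rw [hA]
    rw [abs_le] at q1 q2 ⊢; constructor <;> linarith
  constructor
  · have q1 : |a * y ^ 3| ≤ |a| * ρ ^ 3 := hmul le_rfl p1
    have q2 : |b * (x * y ^ 2 + 2 * x ^ 3 / 3)| ≤ |b| * (5 / 3 * ρ ^ 3) := by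
      apply hmul le_rfl
      rw [abs_le] at p2 p3 ⊢; constructor <;> linarith
    have q3 : |-(x ^ 3 * y) / 8 - 7 * (x * y ^ 3) / 8| ≤ ρ ^ 4 := by
      rw [abs_le] at p4 p5 ⊢; constructor <;> linarith
    have q4 := hmul hab q3
    have q5 := hmul hbb p6
    have q6 : 0 ≤ |a| * ρ ^ 3 := by positivity
    have q7 : 0 ≤ |b| * ρ ^ 3 := by positivity
    have q8 : A ^ 2 * ρ ^ 4 ≤ A ^ 2 * ρ ^ 3 :=
      mul_le_mul_of_nonneg_left (pow_le_pow_of_le_one hρ hρ1 (by norm_num)) (by positivity)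
    have q9 : (2 * A + 2 * A ^ 2) * ρ ^ 3 = 2 * (|a| * ρ ^ 3) + 2 * (|b| * ρ ^ 3)
      + 2 * (A ^ 2 * ρ ^ 3) := by rw [hA]; ring
    have q10 : 0 ≤ A ^ 2 * ρ ^ 4 := by positivity
    rw [q9]
    rw [abs_le] at q1 q2 q4 q5 ⊢; constructor <;> linarith
  · refine (hadd (hmul hF4y hQ) (hmul (hadd (hadd hy hF3y) hF4y) hN)).trans ?_
    have q1 : A ^ 2 * ρ ^ 6 ≤ A ^ 2 * ρ ^ 5 :=
      mul_le_mul_of_nonneg_left (pow_le_pow_of_le_one hρ hρ1 (by norm_num)) (by positivity)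
    have q2 : A ^ 3 * ρ ^ 7 ≤ A ^ 3 * ρ ^ 5 :=
      mul_le_mul_of_nonneg_left (pow_le_pow_of_le_one hρ hρ1 (by norm_num)) (by positivity)
    linarith

lemma exists_small (C ε : ℝ) (hC : 0 ≤ C) (hε : 0 < ε) : ∃ δ : ℝ, 0 < δ ∧ δ ≤ 1 ∧ C * δ ≤ ε := by
  refine ⟨min 1 (ε / (C + 1)), by positivity, min_le_left _ _, ?_⟩
  calc C * min 1 (ε / (C + 1)) ≤ (C + 1) * (ε / (C + 1)) := by
        gcongr
        · linarith
        · exact min_le_right _ _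
    _ = ε := by field_simp

lemma necc_ab {a b : ℝ} (ha : a ≠ 0) (hb : b ≠ 0)
    (hU : ∃ U : Set (ℝ × ℝ), IsOpen U ∧ ((0:ℝ), (0:ℝ)) ∈ U ∧
        ∀ p ∈ U, p ≠ ((0:ℝ), (0:ℝ)) →
          ∃ γ : ℝ → ℝ × ℝ, IsKuklesSol a b 0 γ ∧ IsPeriodicCurve γ ∧
            IsNonconstCurve γ ∧ p ∈ Set.range γ) : False := by
  have hab : a * b ≠ 0 := mul_ne_zero ha hb
  have habp : 0 < |a * b| := abs_pos.2 hab
  obtain ⟨A, hA⟩ : ∃ A, A = |a| + |b| := ⟨_, rfl⟩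
  have hA0 : 0 ≤ A := by rw [hA]; positivity
  obtain ⟨δ, hδ, hδ1, hδ2⟩ := exists_small
    ((15 * A ^ 3 + 4 * A ^ 2 + 2 * A) + (2 * A + 2 * A ^ 2)) (min (1/4) (|a * b| / 16))
    (by positivity) (by positivity)
  have hC1 : (15 * A ^ 3 + 4 * A ^ 2 + 2 * A) * δ ≤ |a * b| / 16 := by
    have h1 := hδ2.trans (min_le_right _ _)
    have : 0 ≤ (2 * A + 2 * A ^ 2) * δ := by positivity
    linarith
  have hC2 : (2 * A + 2 * A ^ 2) * δ ≤ 1 / 4 := by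
    have h1 := hδ2.trans (min_le_left _ _)
    have : 0 ≤ (15 * A ^ 3 + 4 * A ^ 2 + 2 * A) * δ := by positivity
    linarith
  set F : ℝ × ℝ → ℝ := fun q => (q.1 ^ 2 + q.2 ^ 2) / 2 +
    (a * q.2 ^ 3 / 3 - b * (q.1 * q.2 ^ 2 + 2 * q.1 ^ 3 / 3)
      + (a * b * (-(q.1 ^ 3 * q.2) / 8 - 7 * (q.1 * q.2 ^ 3) / 8)
        - (2 * b ^ 2 - a ^ 2) * q.2 ^ 4 / 4)) with hF
  set E : ℝ × ℝ → ℝ := fun q =>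
    (a * b * (-(q.1 ^ 3) / 8 - 21 * (q.1 * q.2 ^ 2) / 8) - (2 * b ^ 2 - a ^ 2) * q.2 ^ 3) *
        (-(a * q.1 * q.2) - b * q.2 ^ 2) +
      (q.2 + (a * q.2 ^ 2 - 2 * b * q.1 * q.2) +
        (a * b * (-(q.1 ^ 3) / 8 - 21 * (q.1 * q.2 ^ 2) / 8) - (2 * b ^ 2 - a ^ 2) * q.2 ^ 3)) *
        (q.2 * (q.1 ^ 2 + q.2 ^ 2) * (a * q.1 + b * q.2)) with hE
  have hEb : ∀ q : ℝ × ℝ, ‖q‖ ≤ δ →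
      |E q| ≤ |a * b| / 16 * (q.1 ^ 2 + q.2 ^ 2) ^ 2 := by
    intro q hq
    obtain ⟨h1, h2⟩ := abs_le_of_norm (le_refl ‖q‖)
    have h := (necc_ab_bounds a b q.1 q.2 ‖q‖ A hA (norm_nonneg _) (hq.trans hδ1) h1 h2).2
    refine (show |E q| ≤ _ from h).trans ?_
    have h3 : (‖q‖ ^ 2) ^ 2 ≤ (q.1 ^ 2 + q.2 ^ 2) ^ 2 := by
      have := sq_norm_le q
      gcongr
    calc (15 * A ^ 3 + 4 * A ^ 2 + 2 * A) * ‖q‖ ^ 5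
        = ((15 * A ^ 3 + 4 * A ^ 2 + 2 * A) * ‖q‖) * (‖q‖ ^ 2) ^ 2 := by ring
      _ ≤ ((15 * A ^ 3 + 4 * A ^ 2 + 2 * A) * δ) * (q.1 ^ 2 + q.2 ^ 2) ^ 2 := by gcongr
      _ ≤ _ := by gcongr
  refine not_center F (fun q => -(a * b / 8) * (q.1 ^ 2 + q.2 ^ 2) ^ 2 + E q) δ (δ ^ 2 / 4) hδ
    (by positivity) (by fun_prop) (by simp [hF]) ?_ ?_ ?_ ?_ hU
  · intro γ hs t
    obtain ⟨h1, h2⟩ := sol_comp hs t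
    have hh := (((h1.pow 2).add (h2.pow 2)).div_const 2).add
      (((((h2.pow 3).const_mul a).div_const 3).sub
        (((h1.mul (h2.pow 2)).add (((h1.pow 3).const_mul 2).div_const 3)).const_mul b)).add
        ((((((h1.pow 3).mul h2).neg.div_const 8).sub
          (((h1.mul (h2.pow 3)).const_mul 7).div_const 8)).const_mul (a * b)).sub
          (((h2.pow 4).const_mul (2 * b ^ 2 - a ^ 2)).div_const 4)))
    convert! hh using 1
    simp only [hE, Nat.cast_ofNat, Pi.pow_apply]
    ring
  · rcases lt_or_gt_of_ne hab with h | h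
    · right
      intro q hq
      have h1 := (abs_le.1 (hEb q hq)).1
      rw [abs_of_neg h] at h1
      have : 0 ≤ -(a * b) * (q.1 ^ 2 + q.2 ^ 2) ^ 2 := mul_nonneg (by linarith) (sq_nonneg _)
      linarith
    · left
      intro q hq
      have h1 := (abs_le.1 (hEb q hq)).2
      rw [abs_of_pos h] at h1
      have : 0 ≤ (a * b) * (q.1 ^ 2 + q.2 ^ 2) ^ 2 := mul_nonneg (by linarith) (sq_nonneg _)
      linarith
  · intro q hq
    have h0 := sq_norm_le q
    rw [hq] at h0
    obtain ⟨h1, h2⟩ := abs_le_of_norm hq.le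
    have h := (abs_le.1 (necc_ab_bounds a b q.1 q.2 δ A hA hδ.le hδ1 h1 h2).1).1
    have h3 : (2 * A + 2 * A ^ 2) * δ ^ 3 ≤ 1 / 4 * δ ^ 2 := by
      calc (2 * A + 2 * A ^ 2) * δ ^ 3 = ((2 * A + 2 * A ^ 2) * δ) * δ ^ 2 := by ring
        _ ≤ _ := by gcongr
    simp only [hF]
    linarith
  · intro q hq h
    have h1 := hEb q hq
    have h2 : E q = a * b / 8 * (q.1 ^ 2 + q.2 ^ 2) ^ 2 := by linarith
    rw [h2, abs_mul, abs_div, abs_of_nonneg (sq_nonneg (q.1 ^ 2 + q.2 ^ 2)),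
      abs_of_pos (show (0:ℝ) < 8 by norm_num)] at h1
    have h3 : |a * b| * (q.1 ^ 2 + q.2 ^ 2) ^ 2 ≤ 0 := by linarith
    have h4 : (q.1 ^ 2 + q.2 ^ 2) ^ 2 ≤ 0 := nonpos_of_mul_nonpos_right h3 habp
    have h5 : q.1 ^ 2 + q.2 ^ 2 = 0 := pow_eq_zero_iff two_ne_zero |>.1 (le_antisymm h4 (sq_nonneg _))
    nlinarith [sq_nonneg q.1, sq_nonneg q.2, pow_eq_zero_iff (two_ne_zero) |>.1
      (le_antisymm (show q.2 ^ 2 ≤ 0 by nlinarith [sq_nonneg q.1]) (sq_nonneg _))]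

lemma lip_of_compact {E G : Type*} [NormedAddCommGroup E] [NormedSpace ℝ E]
    [NormedAddCommGroup G] [NormedSpace ℝ G] (f : E → G) (hf : ContDiff ℝ 1 f) (s : Set E)
    (hs : IsCompact s) (hc : Convex ℝ s) : ∃ K : NNReal, LipschitzOnWith K f s := by
  have h1 : Continuous fun x => ‖fderiv ℝ f x‖₊ := (hf.continuous_fderiv one_ne_zero).nnnorm
  obtain ⟨K, hK⟩ := (hs.image h1).bddAbove
  exact ⟨K, hc.lipschitzOnWith_of_nnnorm_fderiv_le
    (fun x _ => (hf.differentiable one_ne_zero).differentiableAt)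
    (fun x hx => hK ⟨x, hx, rfl⟩)⟩

/-- The Kukles vector field with `c = 0`. -/
def kV (a b : ℝ) (q : ℝ × ℝ) : ℝ × ℝ :=
  (-q.2, q.1 + q.2 * (q.1 ^ 2 + q.2 ^ 2 - 1) * (a * q.1 + b * q.2))

lemma kV_unique (a b M : ℝ) {f g : ℝ → ℝ × ℝ} {u v t₀ : ℝ} (ht : t₀ ∈ Ioo u v)
    (hf : ∀ t ∈ Ioo u v, HasDerivAt f (kV a b (f t)) t ∧ ‖f t‖ ≤ M)
    (hg : ∀ t ∈ Ioo u v, HasDerivAt g (kV a b (g t)) t ∧ ‖g t‖ ≤ M)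
    (h : f t₀ = g t₀) : EqOn f g (Ioo u v) := by
  have hc : ContDiff ℝ 1 (kV a b) := by unfold kV; fun_prop
  obtain ⟨K, hK⟩ := lip_of_compact (kV a b) hc (Metric.closedBall 0 M)
    (isCompact_closedBall _ _) (convex_closedBall _ _)
  exact ODE_solution_unique_of_mem_Ioo (v := fun _ => kV a b)
    (s := fun _ => Metric.closedBall 0 M) (fun _ _ => hK) ht
    (fun t ht => by simpa using hf t ht) (fun t ht => by simpa using hg t ht) h

/-- Picard-Lindelof with localisation of the solution in the ball. -/
lemma pl_exists {f : ℝ → ℝ × ℝ → ℝ × ℝ} {tmin tmax : ℝ} {t₀ : Icc tmin tmax} {x : ℝ × ℝ}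
    {a L K : NNReal} (hf : IsPicardLindelof f t₀ x a 0 L K) :
    ∃ α : ℝ → ℝ × ℝ, α t₀ = x ∧ (∀ t, α t ∈ Metric.closedBall x a) ∧
      ∀ t ∈ Icc tmin tmax, HasDerivWithinAt α (f t (α t)) (Icc tmin tmax) t := by
  have hx : x ∈ Metric.closedBall x ((0 : NNReal) : ℝ) := by simp
  obtain ⟨α, hα⟩ := ODE.FunSpace.exists_isFixedPt_next hf hx
  refine ⟨α.compProj, by rw [ODE.FunSpace.compProj_val, ← hα, ODE.FunSpace.next_apply₀],
    fun t => α.compProj_mem_closedBall hf.mul_max_le, fun t ht ↦ ?_⟩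
  apply ODE.hasDerivWithinAt_picard_Icc t₀.2 hf.continuousOn_uncurry
    α.continuous_compProj.continuousOn (fun _ ht' ↦ α.compProj_mem_closedBall hf.mul_max_le)
    x ht |>.congr_of_mem _ ht
  intro t' ht'
  nth_rw 1 [← hα]
  rw [ODE.FunSpace.compProj_of_mem ht', ODE.FunSpace.next_apply]

/-- Rotation by angle `t`. -/
noncomputable def rotP (t : ℝ) (w : ℝ × ℝ) : ℝ × ℝ :=
  (w.1 * Real.cos t - w.2 * Real.sin t, w.1 * Real.sin t + w.2 * Real.cos t)

/-- The nonlinear part. -/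
def kN (a b : ℝ) (q : ℝ × ℝ) : ℝ := q.2 * (q.1 ^ 2 + q.2 ^ 2 - 1) * (a * q.1 + b * q.2)

lemma norm_rotP (t : ℝ) (w : ℝ × ℝ) : ‖rotP t w‖ ≤ 2 * ‖w‖ := by
  obtain ⟨h1, h2⟩ := abs_le_of_norm (le_refl ‖w‖)
  have hc := Real.abs_cos_le_one t
  have hs := Real.abs_sin_le_one t
  have hmul : ∀ {u v : ℝ}, |u| ≤ ‖w‖ → |v| ≤ 1 → |u * v| ≤ ‖w‖ := by
    intro u v h1 h2
    rw [abs_mul]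
    calc |u| * |v| ≤ ‖w‖ * 1 := mul_le_mul h1 h2 (abs_nonneg _) (norm_nonneg _)
      _ = _ := mul_one _
  rw [Prod.norm_def]
  apply max_le
  · have := (abs_sub (w.1 * Real.cos t) (w.2 * Real.sin t)).trans
      (add_le_add (hmul h1 hc) (hmul h2 hs))
    simp only [rotP, Real.norm_eq_abs]; linarith
  · have := (abs_add_le (w.1 * Real.sin t) (w.2 * Real.cos t)).trans
      (add_le_add (hmul h1 hs) (hmul h2 hc))
    simp only [rotP, Real.norm_eq_abs]; linarith

lemma kN_bound (a b M : ℝ) (q : ℝ × ℝ) (hM : M ≤ 1 / 2) (hq : ‖q‖ ≤ M) :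
    |kN a b q| ≤ (|a| + |b|) * M ^ 2 := by
  obtain ⟨h1, h2⟩ := abs_le_of_norm hq
  have hM0 : 0 ≤ M := (norm_nonneg _).trans hq
  have e1 : q.1 ^ 2 ≤ (1/2) ^ 2 := sq_le_sq' (by linarith [(abs_le.1 h1).1]) (by linarith [(abs_le.1 h1).2])
  have e2 : q.2 ^ 2 ≤ (1/2) ^ 2 := sq_le_sq' (by linarith [(abs_le.1 h2).1]) (by linarith [(abs_le.1 h2).2])
  have e3 : |q.1 ^ 2 + q.2 ^ 2 - 1| ≤ 1 := by
    rw [abs_le]; constructor <;> nlinarith [sq_nonneg q.1, sq_nonneg q.2]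
  have e4 : |a * q.1 + b * q.2| ≤ (|a| + |b|) * M := by
    calc |a * q.1 + b * q.2| ≤ |a| * |q.1| + |b| * |q.2| := by
          rw [← abs_mul, ← abs_mul]; exact abs_add_le _ _
      _ ≤ |a| * M + |b| * M := by gcongr
      _ = _ := by ring
  unfold kN
  rw [abs_mul, abs_mul]
  calc |q.2| * |q.1 ^ 2 + q.2 ^ 2 - 1| * |a * q.1 + b * q.2| ≤ M * 1 * ((|a| + |b|) * M) := by
        gcongr
    _ = _ := by ring

lemma local_sol (a b : ℝ) : ∃ ρ₀ > (0:ℝ), ∀ p : ℝ × ℝ, ‖p‖ < ρ₀ → p ≠ 0 →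
    ∃ γ : ℝ → ℝ × ℝ, γ 0 = p ∧
      (∀ t ∈ Ioo (-20:ℝ) 20, HasDerivAt γ (kV a b (γ t)) t ∧ ‖γ t‖ ≤ 1) ∧
      ∀ t, ∃ w : ℝ × ℝ, γ t = rotP t w ∧ ‖w - p‖ ≤ ‖p‖ / 4 := by
  obtain ⟨ρ₀, h0, h1, h2⟩ := exists_small (8 + 2560 * (|a| + |b|)) 1 (by positivity) one_pos
  refine ⟨ρ₀, h0, fun p hp hp0 => ?_⟩
  have hA : 0 ≤ |a| + |b| := by positivity
  have hpn : 0 < ‖p‖ := norm_pos_iff.2 hp0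
  have hp8 : 8 * ‖p‖ ≤ 1 := by nlinarith
  have hpA : 2560 * (|a| + |b|) * ‖p‖ ≤ 1 := by nlinarith
  set f : ℝ → ℝ × ℝ → ℝ × ℝ := fun t w =>
    (kN a b (rotP t w) * Real.sin t, kN a b (rotP t w) * Real.cos t) with hf
  have hfc : ContDiff ℝ 1 (fun z : ℝ × (ℝ × ℝ) => f z.1 z.2) := by
    simp only [hf, kN, rotP]
    have hs : ContDiff ℝ 1 (fun z : ℝ × (ℝ × ℝ) => Real.sin z.1) := Real.contDiff_sin.comp contDiff_fst
    have hc : ContDiff ℝ 1 (fun z : ℝ × (ℝ × ℝ) => Real.cos z.1) := Real.contDiff_cos.comp contDiff_fst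
    fun_prop
  obtain ⟨K, hK⟩ := lip_of_compact _ hfc (Icc (-20:ℝ) 20 ×ˢ Metric.closedBall p (‖p‖ / 4))
    (isCompact_Icc.prod (isCompact_closedBall _ _)) ((convex_Icc _ _).prod (convex_closedBall _ _))
  have hball : ∀ w ∈ Metric.closedBall p (‖p‖ / 4), ∀ t, ‖rotP t w‖ ≤ 4 * ‖p‖ := by
    intro w hw t
    have h1 := norm_rotP t w
    rw [mem_closedBall_iff_norm] at hw
    have h2 : ‖w‖ ≤ ‖w - p‖ + ‖p‖ := by simpa using norm_add_le (w - p) p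
    linarith
  obtain ⟨R, hR⟩ : ∃ R : NNReal, (R : ℝ) = ‖p‖ / 4 := ⟨⟨‖p‖ / 4, by positivity⟩, rfl⟩
  obtain ⟨L, hL⟩ : ∃ L : NNReal, (L : ℝ) = (|a| + |b|) * (4 * ‖p‖) ^ 2 :=
    ⟨⟨(|a| + |b|) * (4 * ‖p‖) ^ 2, by positivity⟩, rfl⟩
  have hPL : IsPicardLindelof f (⟨0, by norm_num, by norm_num⟩ : Icc (-20:ℝ) 20) p
      R 0 L K := by
    constructor
    · intro t ht x hx y hy
      rw [hR] at hx hy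
      have := hK (show (t, x) ∈ _ from ⟨ht, hx⟩) (show (t, y) ∈ _ from ⟨ht, hy⟩)
      simpa [Prod.edist_eq] using this
    · intro x hx
      exact (hfc.continuous.comp (by fun_prop : Continuous fun t : ℝ => (t, x))).continuousOn
    · intro t ht x hx
      rw [hR] at hx
      rw [hL]
      have h1 := kN_bound a b (4 * ‖p‖) (rotP t x) (by linarith) (hball x hx t)
      have hc := Real.abs_cos_le_one t
      have hs := Real.abs_sin_le_one t
      rw [Prod.norm_def]
      have hnn : 0 ≤ |kN a b (rotP t x)| := abs_nonneg _
      apply max_le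
      · simp only [hf, Real.norm_eq_abs, abs_mul]
        nlinarith
      · simp only [hf, Real.norm_eq_abs, abs_mul]
        nlinarith
    · rw [hR, hL, NNReal.coe_zero]
      norm_num
      nlinarith
  obtain ⟨α, hα0, hαb, hαd⟩ := pl_exists hPL
  rw [hR] at hαb
  refine ⟨fun t => rotP t (α t), ?_, ?_, ?_⟩
  · simp only at hα0
    simp [rotP, hα0]
  · intro t ht
    have hd := (hαd t (Ioo_subset_Icc_self ht)).hasDerivAt (Icc_mem_nhds ht.1 ht.2)
    refine ⟨?_, (hball _ (hαb t) t).trans (by linarith)⟩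
    have h1 : HasDerivAt (fun t => (α t).1) (f t (α t)).1 t := hd.fst
    have h2 : HasDerivAt (fun t => (α t).2) (f t (α t)).2 t := hd.snd
    have hs := Real.hasDerivAt_sin t
    have hc := Real.hasDerivAt_cos t
    have hx := (h1.mul hc).sub (h2.mul hs)
    have hy := (h1.mul hs).add (h2.mul hc)
    have := hx.prodMk hy
    convert! this using 1
    have hsc := Real.sin_sq_add_cos_sq t
    have hn : kV a b (rotP t (α t)) = (-(rotP t (α t)).2, (rotP t (α t)).1 + kN a b (rotP t (α t))) := rfl
    rw [hn]
    simp only [hf]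
    set n := kN a b (rotP t (α t))
    refine Prod.ext ?_ ?_
    · simp only [rotP]; ring
    · simp only [rotP]; linear_combination (-n) * hsc
  · intro t
    exact ⟨α t, rfl, mem_closedBall_iff_norm.1 (hαb t)⟩

/-- Along an approximate rotation, a linear functional has two zeros. -/
lemma crossing (p : ℝ × ℝ) (hp : p ≠ 0) (γ : ℝ → ℝ × ℝ) (hγ : ContinuousOn γ (Ioo (-20:ℝ) 20))
    (h : ∀ t, ∃ w : ℝ × ℝ, γ t = rotP t w ∧ ‖w - p‖ ≤ ‖p‖ / 4) (φ : ℝ) (hφ0 : 0 ≤ φ) (hφ : φ ≤ 2) :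
    ∃ t₁ t₂ : ℝ, -4 < t₁ ∧ t₁ < t₂ ∧ t₂ < t₁ + 8 ∧ 2 * t₂ - t₁ < 20 ∧
      (γ t₁).1 * Real.cos φ + (γ t₁).2 * Real.sin φ = 0 ∧
      (γ t₂).1 * Real.cos φ + (γ t₂).2 * Real.sin φ = 0 := by
  have hpn : 0 < ‖p‖ := norm_pos_iff.2 hp
  obtain ⟨r, θ, hr, hθ1, hθ2, hp1, hp2⟩ : ∃ r θ : ℝ, ‖p‖ ≤ r ∧ -Real.pi < θ ∧ θ ≤ Real.pi ∧
      p.1 = r * Real.cos θ ∧ p.2 = r * Real.sin θ := by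
    let z : ℂ := ⟨p.1, p.2⟩
    refine ⟨‖z‖, z.arg, ?_, Complex.neg_pi_lt_arg z, Complex.arg_le_pi z, ?_, ?_⟩
    · rw [Prod.norm_def]
      exact max_le (Complex.abs_re_le_norm z) (Complex.abs_im_le_norm z)
    · rw [Complex.norm_mul_cos_arg]
    · rw [Complex.norm_mul_sin_arg]
  set g : ℝ → ℝ := fun t => (γ t).1 * Real.cos φ + (γ t).2 * Real.sin φ with hg
  have happ : ∀ t, |g t - r * Real.cos (θ + t - φ)| ≤ ‖p‖ / 2 := by
    intro t
    obtain ⟨w, hw, hwp⟩ := h t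
    obtain ⟨e1, e2⟩ := abs_le_of_norm hwp
    have : g t - r * Real.cos (θ + t - φ) =
        (w - p).1 * Real.cos (t - φ) + (w - p).2 * (-Real.sin (t - φ)) := by
      simp only [hg, hw, rotP, Prod.fst_sub, Prod.snd_sub, hp1, hp2]
      rw [show θ + t - φ = θ + (t - φ) by ring, Real.cos_add, Real.cos_sub, Real.sin_sub]
      ring
    rw [this]
    refine (abs_add_le _ _).trans ?_
    rw [abs_mul, abs_mul, abs_neg]
    have hc := Real.abs_cos_le_one (t - φ)
    have hs := Real.abs_sin_le_one (t - φ)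
    have := mul_le_mul e1 hc (abs_nonneg _) (by positivity)
    have := mul_le_mul e2 hs (abs_nonneg _) (by positivity)
    linarith
  have hpi1 := Real.pi_gt_three
  have hpi2 := Real.pi_lt_d2
  have hgc : ContinuousOn g (Ioo (-20:ℝ) 20) := by
    simp only [hg]; fun_prop
  have g0 : 0 < g (φ - θ) := by
    have := (abs_le.1 (happ (φ - θ))).1
    rw [show θ + (φ - θ) - φ = 0 by ring, Real.cos_zero] at this
    linarith
  have g1 : g (φ - θ + Real.pi) < 0 := by
    have := (abs_le.1 (happ (φ - θ + Real.pi))).2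
    rw [show θ + (φ - θ + Real.pi) - φ = Real.pi by ring, Real.cos_pi] at this
    linarith
  have g2 : 0 < g (φ - θ + 2 * Real.pi) := by
    have := (abs_le.1 (happ (φ - θ + 2 * Real.pi))).1
    rw [show θ + (φ - θ + 2 * Real.pi) - φ = 2 * Real.pi by ring, Real.cos_two_pi] at this
    linarith
  obtain ⟨t₁, ht₁, hz₁⟩ := intermediate_value_Ioo' (f := g) (a := φ - θ) (b := φ - θ + Real.pi)
    (by linarith) (hgc.mono fun t ht => ⟨by linarith [ht.1], by linarith [ht.2]⟩) ⟨g1, g0⟩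
  obtain ⟨t₂, ht₂, hz₂⟩ := intermediate_value_Ioo (f := g) (a := φ - θ + Real.pi)
    (b := φ - θ + 2 * Real.pi)
    (by linarith) (hgc.mono fun t ht => ⟨by linarith [ht.1], by linarith [ht.2]⟩) ⟨g1, g2⟩
  obtain ⟨a1, a2⟩ := ht₁
  obtain ⟨b1, b2⟩ := ht₂
  exact ⟨t₁, t₂, by linarith, by linarith, by linarith, by linarith, hz₁, hz₂⟩

/-- Gluing: a solution on `(-20,20)` returning to its value after time `P` yields a periodic one. -/
lemma glue (a b : ℝ) (γ : ℝ → ℝ × ℝ) (P t₁ : ℝ) (hP : 0 < P) (hP' : P < 16)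
    (h : ∀ t ∈ Ioo (-20:ℝ) 20, HasDerivAt γ (kV a b (γ t)) t ∧ ‖γ t‖ ≤ 1)
    (ht₁ : -20 < t₁) (ht₂ : t₁ + P < 20) (hret : γ (t₁ + P) = γ t₁) :
    ∃ Γ : ℝ → ℝ × ℝ, IsKuklesSol a b 0 Γ ∧ IsPeriodicCurve Γ ∧ Γ 0 = γ 0 := by
  have hsh : EqOn (fun t => γ (t + P)) γ (Ioo (-20) (20 - P)) := by
    refine kV_unique a b 1 (t₀ := t₁) ⟨ht₁, by linarith⟩ ?_ ?_ hret
    · intro t ht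
      obtain ⟨h1, h2⟩ := h (t + P) ⟨by linarith [ht.1], by linarith [ht.2]⟩
      exact ⟨h1.comp_add_const t P, h2⟩
    · intro t ht
      exact h t ⟨ht.1, by linarith [ht.2]⟩
  refine ⟨fun t => γ (toIcoMod hP 0 t), ?_, ⟨P, hP, fun t => by simp⟩, by simp⟩
  intro t
  set s := toIcoMod hP 0 t with hs
  set k := toIcoDiv hP 0 t with hk
  have hsk : t = s + k * P := by
    have := toIcoMod_add_toIcoDiv_zsmul hP 0 t
    rw [zsmul_eq_mul] at this
    exact this.symm
  have hsm := toIcoMod_mem_Ico hP 0 t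
  rw [← hs] at hsm
  have hs0 : 0 ≤ s := hsm.1
  have hs1 : s < P := by linarith [hsm.2]
  have hev : (fun u => γ (toIcoMod hP 0 u)) =ᶠ[𝓝 t] fun u => γ (u - k * P) := by
    have hc : Tendsto (fun u : ℝ => u - k * P) (𝓝 t) (𝓝 s) := by
      have : Continuous (fun u : ℝ => u - k * P) := by fun_prop
      have h2 := this.tendsto t
      rwa [show t - k * P = s by rw [hsk]; ring] at h2
    have hm := hc.eventually (Ioo_mem_nhds (show max (-P) (-20) < s by
      apply max_lt <;> linarith) hs1)
    filter_upwards [hm] with u hu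
    have hu1 : -P < u - k * P := (le_max_left _ _).trans_lt hu.1
    have hu2 : -20 < u - k * P := (le_max_right _ _).trans_lt hu.1
    by_cases hc0 : 0 ≤ u - k * P
    · have : toIcoMod hP 0 u = u - k * P := by
        rw [toIcoMod_eq_iff hP]
        refine ⟨⟨hc0, by linarith [hu.2]⟩, k, ?_⟩
        rw [zsmul_eq_mul]; ring
      rw [this]
    · push Not at hc0
      have : toIcoMod hP 0 u = (u - k * P) + P := by
        rw [toIcoMod_eq_iff hP]
        refine ⟨⟨by linarith, by linarith⟩, k - 1, ?_⟩
        rw [zsmul_eq_mul]; push_cast; ring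
      rw [this]
      exact hsh ⟨hu2, by linarith⟩
  have hd := (h s ⟨by linarith, by linarith⟩).1
  have hd' : HasDerivAt (fun u => γ (u - k * P)) (kV a b (γ s)) t := by
    apply HasDerivAt.comp_sub_const
    rwa [show t - k * P = s by rw [hsk]; ring]
  have := hd'.congr_of_eventuallyEq hev
  convert! this using 1
  simp only [kV, add_zero]
  rfl

lemma suff (a b σ φ : ℝ) (hφ0 : 0 ≤ φ) (hφ : φ ≤ 2) (hσ : σ * σ = 1)
    (hrev : ∀ q : ℝ × ℝ, kV a b (-σ * q.1, σ * q.2) = (σ * (kV a b q).1, -σ * (kV a b q).2))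
    (hfix : ∀ q : ℝ × ℝ, q.1 * Real.cos φ + q.2 * Real.sin φ = 0 → (-σ * q.1, σ * q.2) = q) :
    ∃ U : Set (ℝ × ℝ), IsOpen U ∧ ((0:ℝ), (0:ℝ)) ∈ U ∧
        ∀ p ∈ U, p ≠ ((0:ℝ), (0:ℝ)) →
          ∃ γ : ℝ → ℝ × ℝ, IsKuklesSol a b 0 γ ∧ IsPeriodicCurve γ ∧
            IsNonconstCurve γ ∧ p ∈ Set.range γ := by
  obtain ⟨ρ₀, h0, hsol⟩ := local_sol a b
  refine ⟨Metric.ball 0 ρ₀, Metric.isOpen_ball, Metric.mem_ball_self h0, fun p hp hp0 => ?_⟩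
  obtain ⟨γ, hγ0, hγd, hγa⟩ := hsol p (by simpa using hp) hp0
  have hγc : ContinuousOn γ (Ioo (-20:ℝ) 20) :=
    fun t ht => (hγd t ht).1.continuousAt.continuousWithinAt
  obtain ⟨t₁, t₂, h1, h2, h3, h4, z1, z2⟩ := crossing p hp0 γ hγc hγa φ hφ0 hφ
  have habs : |σ| = 1 := by
    have : |σ| * |σ| = 1 := by rw [← abs_mul, hσ, abs_one]
    nlinarith [abs_nonneg σ]
  have hrefl : EqOn (fun t => (-σ * (γ (2 * t₂ - t)).1, σ * (γ (2 * t₂ - t)).2)) γ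
      (Ioo (max (-20) (2 * t₂ - 20)) (min 20 (2 * t₂ + 20))) := by
    have hm : t₂ ∈ Ioo (max (-20) (2 * t₂ - 20)) (min 20 (2 * t₂ + 20)) :=
      ⟨max_lt (by linarith) (by linarith), lt_min (by linarith) (by linarith)⟩
    refine kV_unique a b 1 hm ?_ ?_ ?_
    · intro t ht
      obtain ⟨i1, i2⟩ := max_lt_iff.1 ht.1
      obtain ⟨i3, i4⟩ := lt_min_iff.1 ht.2
      obtain ⟨hd, hn⟩ := hγd (2 * t₂ - t) ⟨by linarith, by linarith⟩
      have hd2 := hd.comp_const_sub (2 * t₂) t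
      constructor
      · have h1 : HasDerivAt (fun t => (γ (2 * t₂ - t)).1) (-kV a b (γ (2 * t₂ - t))).1 t := hd2.fst
        have h2 : HasDerivAt (fun t => (γ (2 * t₂ - t)).2) (-kV a b (γ (2 * t₂ - t))).2 t := hd2.snd
        have := (h1.const_mul (-σ)).prodMk (h2.const_mul σ)
        convert! this using 1
        rw [hrev]
        simp
      · rw [Prod.norm_def] at hn ⊢
        simpa [habs] using hn
    · intro t ht
      obtain ⟨i1, i2⟩ := max_lt_iff.1 ht.1
      obtain ⟨i3, i4⟩ := lt_min_iff.1 ht.2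
      exact hγd t ⟨by linarith, by linarith⟩
    · simp only [show 2 * t₂ - t₂ = t₂ by ring]
      exact hfix _ z2
  have hret : γ (t₁ + 2 * (t₂ - t₁)) = γ t₁ := by
    have hm : 2 * t₂ - t₁ ∈ Ioo (max (-20) (2 * t₂ - 20)) (min 20 (2 * t₂ + 20)) :=
      ⟨max_lt (by linarith) (by linarith), lt_min (by linarith) (by linarith)⟩
    have h := hrefl hm
    simp only [show 2 * t₂ - (2 * t₂ - t₁) = t₁ by ring] at h
    rw [hfix _ z1] at h
    rw [h]; congr 1; ring
  obtain ⟨Γ, hΓ, hper, hΓ0⟩ := glue a b γ (2 * (t₂ - t₁)) t₁ (by linarith) (by linarith) hγd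
    (by linarith) (by linarith) hret
  refine ⟨Γ, hΓ, hper, ?_, 0, hΓ0.trans hγ0⟩
  by_contra hcon
  unfold IsNonconstCurve at hcon
  push Not at hcon
  have hcst : Γ = fun _ => Γ 0 := funext fun t => hcon t 0
  have hd0 : HasDerivAt Γ 0 0 := by rw [hcst]; exact hasDerivAt_const _ _
  have h5 := (hΓ 0).unique hd0
  rw [hΓ0, hγ0] at h5
  have e1 := congrArg Prod.fst h5
  have e2 := congrArg Prod.snd h5
  simp only [Prod.fst_zero, Prod.snd_zero, neg_eq_zero] at e1 e2
  rw [e1] at e2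
  exact hp0 (Prod.ext (by simpa using e2) e1)

/-- The Kukles system has a center at the origin — i.e. there is an
open neighborhood `U` of `(0,0)` such that every point `p ∈ U`, `p ≠ (0,0)`, lies
on the image of a nonconstant periodic solution — if and only if `c = 0` and
(`a = 0` or `b = 0`). -/
theorem kukles_center_conditions (a b c : ℝ) :
    (∃ U : Set (ℝ × ℝ), IsOpen U ∧ ((0:ℝ), (0:ℝ)) ∈ U ∧
        ∀ p ∈ U, p ≠ ((0:ℝ), (0:ℝ)) →
          ∃ γ : ℝ → ℝ × ℝ, IsKuklesSol a b c γ ∧ IsPeriodicCurve γ ∧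
            IsNonconstCurve γ ∧ p ∈ Set.range γ)
      ↔ (c = 0 ∧ (a = 0 ∨ b = 0)) := by
  constructor
  · intro hU
    have hc : c = 0 := by
      by_contra hc
      exact necc_c hc hU
    subst hc
    refine ⟨rfl, ?_⟩
    by_contra! h
    exact necc_ab h.1 h.2 hU
  · rintro ⟨rfl, rfl | rfl⟩
    · refine suff 0 b (-1) (Real.pi / 2) (by positivity) (by linarith [Real.pi_lt_d2])
        (by norm_num) ?_ ?_
      · intro q
        simp only [kV, Prod.mk.injEq]
        constructor <;> ring
      · intro q hq
        simp at hq
        ext <;> simp [hq]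
    · refine suff a 0 1 0 le_rfl (by norm_num) (by norm_num) ?_ ?_
      · intro q
        simp only [kV, Prod.mk.injEq]
        constructor <;> ring
      · intro q hq
        simp at hq
        ext <;> simp [hq]
end
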